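/- arXiv:2011.10623 — 2 statements merged into one kernel-verified Lean document; each statement's English description precedes it below -/
import Mathlib

section
/- If G is a 2-path with diam(G) = d and n vertices, then for every t ≥ 1 the t-fold pebbling number satisfies π_t(G) = t·2^d + n − 2d. -/
/-- A single pebbling step: remove two pebbles from `u` and add one to an adjacent `v`. -/
def PebblingStep {V : Type} [DecidableEq V] (G : SimpleGraph V) (C C' : V → ℕ) : Prop :=
  ∃ u v : V, G.Adj u v ∧ 2 ≤ C u ∧
    C' = fun w => if w = u then C u - 2 else if w = v then C v + 1 else C w

/-- `C` solves the target distribution `D`: some sequence of pebbling steps reaches a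
configuration with at least `D v` pebbles on each vertex `v`. -/
def Solvable {V : Type} [DecidableEq V] (G : SimpleGraph V) (C D : V → ℕ) : Prop :=
  ∃ C' : V → ℕ, Relation.ReflTransGen (PebblingStep G) C C' ∧ ∀ v, D v ≤ C' v

/-- The distribution with `t` pebbles stacked on `r` and none elsewhere. -/
def stack {V : Type} [DecidableEq V] (r : V) (t : ℕ) : V → ℕ :=
  fun v => if v = r then t else 0

/-- The pebbling number of the demand `D` in `G`: the smallest `m` such that every
configuration of size `m` is `D`-solvable. -/
noncomputable def pebblingNumber {V : Type} [Fintype V] [DecidableEq V] (G : SimpleGraph V) (D : V → ℕ) : ℕ :=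
  sInf {m | ∀ C : V → ℕ, (∑ v, C v) = m → Solvable G C D}

/-- The `t`-fold pebbling number of `G`. -/
noncomputable def tPebblingNumber {V : Type} [Fintype V] [DecidableEq V]
    (G : SimpleGraph V) (t : ℕ) : ℕ :=
  Finset.univ.sup fun r => pebblingNumber G (stack r t)

/-- Reaching `C'` from `C` by exactly `k` pebbling steps. -/
inductive StepsN {V : Type} [DecidableEq V] (G : SimpleGraph V) : ℕ → (V → ℕ) → (V → ℕ) → Prop
  | refl (C : V → ℕ) : StepsN G 0 C C
  | tail {k : ℕ} {C C' C'' : V → ℕ} :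
      StepsN G k C C' → PebblingStep G C' C'' → StepsN G (k + 1) C C''

/-- `C` has an `r`-solution of cost at most `c` (cost = number of pebbling steps plus one). -/
def CheaplySolvable {V : Type} [DecidableEq V] (G : SimpleGraph V) (C : V → ℕ) (r : V) (c : ℕ) : Prop :=
  ∃ (k : ℕ) (C' : V → ℕ), StepsN G k C C' ∧ 1 ≤ C' r ∧ k + 1 ≤ c

/-- The eccentricity of a vertex: the maximum distance to any other vertex. -/
noncomputable def eccentricity {V : Type} [Fintype V] (G : SimpleGraph V) (r : V) : ℕ :=
  Finset.univ.sup fun v => G.dist r v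

/-- A vertex is simplicial if its neighborhood induces a complete graph. -/
def IsSimplicial {V : Type} (G : SimpleGraph V) (v : V) : Prop :=
  ∀ a b : V, G.Adj v a → G.Adj v b → a ≠ b → G.Adj a b

/-- A 2-path is either `K₂` or `K₃`, or a graph with exactly two simplicial vertices
`u` and `v` such that the neighborhood of `v` induces `K₂` and `G - v` is a 2-path. -/
inductive IsTwoPath : {V : Type} → SimpleGraph V → Prop
  | complete2 {V : Type} (G : SimpleGraph V) :
      Nat.card V = 2 → (∀ a b : V, a ≠ b → G.Adj a b) → IsTwoPath G
  | complete3 {V : Type} (G : SimpleGraph V) :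
      Nat.card V = 3 → (∀ a b : V, a ≠ b → G.Adj a b) → IsTwoPath G
  | extend {V : Type} (G : SimpleGraph V) (u v : V) :
      u ≠ v →
      {w : V | IsSimplicial G w} = {u, v} →
      (G.neighborSet v).ncard = 2 →
      IsSimplicial G v →
      IsTwoPath (G.induce {w : V | w ≠ v}) →
      IsTwoPath G

/-- The Kneser graph `K(m, h)`: vertices are the `h`-element subsets of `{1, …, m}`,
adjacent iff disjoint. -/
def kneserGraph (m h : ℕ) : SimpleGraph {s : Finset (Fin m) // s.card = h} :=
  SimpleGraph.fromRel fun a b => Disjoint a.1 b.1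

namespace TwoPath

section Pebbling

variable {V : Type} [DecidableEq V] {G : SimpleGraph V}

/-- Reachability by a sequence of pebbling steps. -/
abbrev Reach (G : SimpleGraph V) (C C' : V → ℕ) : Prop :=
  Relation.ReflTransGen (PebblingStep G) C C'

theorem pebblingStep_add_single {u v : V} (h : G.Adj u v) (E : V → ℕ) :
    PebblingStep G (E + Pi.single u 2) (E + Pi.single v 1) := by
  refine ⟨u, v, h, by simp, funext fun w => ?_⟩
  have := h.ne
  have := h.ne'
  by_cases hu : w = u
  · subst hu; simp [*]
  · by_cases hv : w = v
    · subst hv; simp [*]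
    · simp [*]

theorem exists_eq_add_single {C C' : V → ℕ} (h : PebblingStep G C C') :
    ∃ (u v : V) (E : V → ℕ), G.Adj u v ∧ C = E + Pi.single u 2 ∧ C' = E + Pi.single v 1 := by
  obtain ⟨u, v, huv, h2, rfl⟩ := h
  refine ⟨u, v, C - Pi.single u 2, huv, ?_, ?_⟩
  · funext w
    by_cases hu : w = u
    · subst hu; simp; omega
    · simp [hu]
  · have := huv.ne
    have := huv.ne'
    funext w
    by_cases hu : w = u
    · subst hu; simp [*]
    · by_cases hv : w = v
      · subst hv; simp [*]
      · simp [*]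

theorem Reach.add_right {C C' : V → ℕ} (h : Reach G C C') (E : V → ℕ) :
    Reach G (C + E) (C' + E) := by
  induction h with
  | refl => exact .refl
  | tail _ hs ih =>
    obtain ⟨u, v, F, huv, rfl, rfl⟩ := exists_eq_add_single hs
    refine ih.tail ?_
    rw [add_right_comm F (Pi.single u 2), add_right_comm F (Pi.single v 1)]
    exact pebblingStep_add_single huv _

theorem reach_single {u v : V} (h : G.Adj u v) (E : V → ℕ) (k : ℕ) :
    Reach G (E + Pi.single u (2 * k)) (E + Pi.single v k) := by
  induction k generalizing E with
  | zero => simpa using Relation.ReflTransGen.refl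
  | succ k ih =>
    have h1 : E + Pi.single u (2 * (k + 1)) = E + Pi.single u (2 * k) + Pi.single u 2 := by
      rw [add_assoc, ← Pi.single_add]; rfl
    have h2 : E + Pi.single v (k + 1) = E + Pi.single v 1 + Pi.single v k := by
      rw [add_assoc, ← Pi.single_add, add_comm k 1]
    rw [h1, h2]
    have := ih (E + Pi.single v 1)
    rw [add_right_comm] at this
    exact Relation.ReflTransGen.head (pebblingStep_add_single h _) this

/-- All pairs on `u` can be moved to a neighbour `v`. -/
theorem exists_reach_pairs {u v : V} (h : G.Adj u v) (C : V → ℕ) :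
    ∃ C', Reach G C C' ∧ C' v = C v + C u / 2 ∧ ∀ w, w ≠ u → w ≠ v → C' w = C w := by
  have := reach_single h (C - Pi.single u (2 * (C u / 2))) (C u / 2)
  have hC : C - Pi.single u (2 * (C u / 2)) + Pi.single u (2 * (C u / 2)) = C := by
    funext w
    by_cases hu : w = u
    · subst hu; simp; omega
    · simp [hu]
  rw [hC] at this
  refine ⟨_, this, ?_, fun w hu hv => ?_⟩
  · simp [h.ne']
  · simp [hu, hv]

/-- The pairs of pebbles on a set of neighbours of `h` can be collected on `h`. -/
theorem exists_reach_collect {h : V} (L : Finset V) (hL : ∀ z ∈ L, G.Adj z h) (C : V → ℕ) :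
    ∃ C', Reach G C C' ∧ C' h = C h + ∑ z ∈ L, C z / 2 ∧
      ∀ w, w ∉ L → w ≠ h → C' w = C w := by
  induction L using Finset.induction_on with
  | empty => exact ⟨C, .refl, by simp, fun _ _ _ => rfl⟩
  | insert z L hz ih =>
    obtain ⟨C', hr, hh, ho⟩ := ih fun z hz => hL z (Finset.mem_insert_of_mem hz)
    have hzh := hL z (Finset.mem_insert_self _ _)
    obtain ⟨C'', hr', hh', ho'⟩ := exists_reach_pairs hzh C'
    refine ⟨C'', hr.trans hr', ?_, fun w hw hwh => ?_⟩
    · rw [hh', hh, ho z hz hzh.ne, Finset.sum_insert hz]; omega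
    · rw [Finset.mem_insert, not_or] at hw
      rw [ho' w hw.1 hwh, ho w hw.2 hwh]

/-- `C` is `t`-fold `r`-solvable. -/
def Sol (G : SimpleGraph V) (r : V) (t : ℕ) (C : V → ℕ) : Prop :=
  ∃ C', Reach G C C' ∧ t ≤ C' r

theorem sol_iff {r : V} {t : ℕ} {C : V → ℕ} : Solvable G C (stack r t) ↔ Sol G r t C := by
  refine exists_congr fun C' => and_congr_right fun _ => ⟨fun h => ?_, fun h v => ?_⟩
  · simpa [stack] using h r
  · unfold stack; split_ifs with hv
    · exact hv ▸ h
    · exact Nat.zero_le _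

theorem Sol.of_le {r : V} {t : ℕ} {C : V → ℕ} (h : t ≤ C r) : Sol G r t C := ⟨C, .refl, h⟩

theorem Sol.of_reach {r : V} {t : ℕ} {C C' : V → ℕ} (h : Reach G C C') (hs : Sol G r t C') :
    Sol G r t C :=
  let ⟨D, hD, ht⟩ := hs
  ⟨D, h.trans hD, ht⟩

theorem Sol.add {r : V} {s t : ℕ} {C E : V → ℕ} (hC : Sol G r s C) (hE : Sol G r t E) :
    Sol G r (s + t) (C + E) := by
  obtain ⟨C', h, hs⟩ := hC
  obtain ⟨E', h', ht⟩ := hE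
  refine ⟨C' + E', (h.add_right E).trans ?_, Nat.add_le_add hs ht⟩
  rw [add_comm C', add_comm C']
  exact h'.add_right C'

theorem Sol.mono {r : V} {s t : ℕ} {C C' : V → ℕ} (h : Sol G r t C) (hst : s ≤ t)
    (hC : ∀ w, C w ≤ C' w) : Sol G r s C' := by
  have : C + (C' - C) = C' := funext fun w => Nat.add_sub_cancel' (hC w)
  obtain ⟨D, hD, ht⟩ := h.add (Sol.of_le (C := C' - C) (G := G) (r := r) (Nat.zero_le _))
  exact ⟨D, this ▸ hD, by omega⟩

/-- There is a path inside `L` from the vertex to a neighbour of `Y`. -/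
inductive Conn (G : SimpleGraph V) (Y : Finset V) : Finset V → V → Prop
  | base {L : Finset V} {z y : V} : z ∈ L → y ∈ Y → G.Adj z y → Conn G Y L z
  | step {L : Finset V} {z z' : V} : z ∈ L → G.Adj z z' → Conn G Y (L.erase z) z' → Conn G Y L z

theorem Conn.mem {Y L : Finset V} {z : V} (h : Conn G Y L z) : z ∈ L := by
  cases h <;> assumption

theorem Conn.mono {Y L L' : Finset V} {z : V} (h : Conn G Y L z) (hL : L ⊆ L') :
    Conn G Y L' z := by
  induction h generalizing L' with
  | base hz hy ha => exact .base (hL hz) hy ha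
  | step hz ha _ ih => exact .step (hL hz) ha (ih (Finset.erase_subset_erase _ hL))

/-- If all other vertices of `L` carry an odd number of pebbles, a pair on `z` can be shifted along
a path in `L`, so that one pebble reaches `Y` and all other pairs in `L` survive. -/
theorem Conn.exists_reach {Y L : Finset V} {z : V} (h : Conn G Y L z) (hY : Disjoint Y L)
    {C : V → ℕ} (hodd : ∀ w ∈ L, w ≠ z → C w % 2 = 1) (hz2 : 2 ≤ C z) :
    ∃ y ∈ Y, ∃ C', Reach G C C' ∧ (∀ w, w ∉ L → C' w = C w + if w = y then 1 else 0) ∧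
      ∑ w ∈ L, C w / 2 ≤ ∑ w ∈ L, C' w / 2 + 1 := by
  induction h generalizing C with
  | @base L z y hz hy ha =>
    have hyL : y ∉ L := Finset.disjoint_left.1 hY hy
    refine ⟨y, hy, _, .single ⟨z, y, ha, hz2, rfl⟩, fun w hw => ?_, ?_⟩
    · have : w ≠ z := fun h => hw (h ▸ hz)
      by_cases hwy : w = y
      · subst hwy; simp [this]
      · simp [this, hwy]
    · rw [← Finset.add_sum_erase _ _ hz, ← Finset.add_sum_erase L (fun w => _ / 2) hz]
      have : ∑ x ∈ L.erase z, (if x = z then C z - 2 else if x = y then C y + 1 else C x) / 2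
          = ∑ x ∈ L.erase z, C x / 2 := by
        refine Finset.sum_congr rfl fun x hx => ?_
        rw [Finset.mem_erase] at hx
        have : x ≠ y := fun h => hyL (h ▸ hx.2)
        simp [hx.1, this]
      simp only [this, if_true]
      omega
  | @step L z z' hz ha hc ih =>
    have hz' := Finset.mem_erase.1 hc.mem
    set C₁ : V → ℕ := fun w => if w = z then C z - 2 else if w = z' then C z' + 1 else C w with hC₁
    have hz'o := hodd z' hz'.2 hz'.1
    obtain ⟨y, hy, C', hr, ho, hs⟩ := ih (C := C₁) (hY.mono_right (Finset.erase_subset _ _))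
      (fun w hw hwz' => by
        rw [Finset.mem_erase] at hw
        simpa [hC₁, hw.1, hwz'] using hodd w hw.2 hw.1)
      (by simp [hC₁, hz'.1]; omega)
    have hyz : z ≠ y := fun h => Finset.disjoint_left.1 hY hy (h ▸ hz)
    refine ⟨y, hy, C', .head ⟨z, z', ha, hz2, rfl⟩ hr, fun w hw => ?_, ?_⟩
    · rw [ho w fun h => hw (Finset.mem_of_mem_erase h)]
      have h1 : w ≠ z := fun h => hw (h ▸ hz)
      have h2 : w ≠ z' := fun h => hw (h ▸ hz'.2)
      simp [hC₁, h1, h2]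
    · have hCz : C' z = C z - 2 := by
        rw [ho z (by simp)]; simp [hC₁, hyz]
      rw [← Finset.add_sum_erase _ _ hz, ← Finset.add_sum_erase L (fun w => C' w / 2) hz]
      have hs1 : ∑ w ∈ L.erase z, C₁ w / 2 = ∑ w ∈ L.erase z, C w / 2 + 1 := by
        rw [← Finset.add_sum_erase _ _ hc.mem, ← Finset.add_sum_erase _ (fun w => C w / 2) hc.mem]
        have : ∑ w ∈ (L.erase z).erase z', C₁ w / 2 = ∑ w ∈ (L.erase z).erase z', C w / 2 := by
          refine Finset.sum_congr rfl fun x hx => ?_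
          simp only [Finset.mem_erase] at hx
          simp [hC₁, hx.1, hx.2.1]
        have h3 : C₁ z' = C z' + 1 := by simp [hC₁, hz'.1]
        rw [this, h3]; omega
      simp only [hCz] at *
      omega

end Pebbling

section Sums

variable {V : Type}

theorem sum_eq_two_mul_add_mod (L : Finset V) (C : V → ℕ) :
    ∑ z ∈ L, C z = 2 * ∑ z ∈ L, C z / 2 + ∑ z ∈ L, C z % 2 := by
  rw [Finset.mul_sum, ← Finset.sum_add_distrib]
  exact Finset.sum_congr rfl fun z _ => (Nat.div_add_mod _ _).symm

theorem sum_mod_two_le_card (L : Finset V) (C : V → ℕ) : ∑ z ∈ L, C z % 2 ≤ L.card := by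
  have := Finset.sum_le_card_nsmul L (fun z => C z % 2) 1 fun z _ => by omega
  simpa using this

theorem sum_le_card_of_le_one {L : Finset V} {C : V → ℕ} (h : ∀ z ∈ L, C z ≤ 1) :
    ∑ z ∈ L, C z ≤ L.card := by
  have := Finset.sum_le_card_nsmul L (fun z => C z) 1 h
  simpa using this

theorem odd_of_card_le_sum_mod_two {L : Finset V} {C : V → ℕ} (h : L.card ≤ ∑ z ∈ L, C z % 2) :
    ∀ z ∈ L, C z % 2 = 1 := by
  have h1 : ∑ z ∈ L, C z % 2 = ∑ z ∈ L, 1 :=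
    le_antisymm (by simpa using sum_mod_two_le_card L C) (by simpa using h)
  exact (Finset.sum_eq_sum_iff_of_le fun z _ => by omega).1 h1

theorem exists_pair {L : Finset V} {C : V → ℕ} (h : 0 < ∑ z ∈ L, C z / 2) :
    ∃ z ∈ L, 2 ≤ C z := by
  obtain ⟨z, hz, h0⟩ := Finset.exists_ne_zero_of_sum_ne_zero h.ne'
  exact ⟨z, hz, by omega⟩

end Sums

section Layers

variable {V : Type} [DecidableEq V] {G : SimpleGraph V} {r : V}

/-- `Lay G r i S L h`: around the root `r`, `S` is the union of the layers below `i`, and `L` is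
the `i`-th layer. All vertices of `L` are adjacent to the vertex `h` of the previous layer, and from
each of them a path in `L` leads to a neighbour of another vertex of the previous layer. -/
inductive Lay (G : SimpleGraph V) (r : V) : ℕ → Finset V → Finset V → V → Prop
  | base {L : Finset V} : L.Nonempty → r ∉ L → (∀ z ∈ L, G.Adj z r) → Lay G r 1 {r} L r
  | step {i : ℕ} {S L L' : Finset V} {h p : V} : Lay G r i S L h → p ∈ L → L'.Nonempty →
      Disjoint (S ∪ L) L' → (∀ z ∈ L', G.Adj z p) → (∀ z ∈ L', Conn G (L.erase p) L' z) →
      Lay G r (i + 1) (S ∪ L) L' p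

theorem Lay.nonempty {i : ℕ} {S L : Finset V} {h : V} (H : Lay G r i S L h) : L.Nonempty := by
  cases H <;> assumption

theorem Lay.pos {i : ℕ} {S L : Finset V} {h : V} (H : Lay G r i S L h) : 1 ≤ i := by
  cases H <;> omega

theorem Lay.hub_mem {i : ℕ} {S L : Finset V} {h : V} (H : Lay G r i S L h) : h ∈ S := by
  cases H
  · simp
  · simp [*]

theorem Lay.insert {i : ℕ} {S L : Finset V} {h v z : V} (H : Lay G r i S L h) (hv : v ∈ L)
    (hz : z ∉ S ∪ L) (hzh : G.Adj z h) (hzv : G.Adj z v) : Lay G r i S (insert z L) h := by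
  rw [Finset.mem_union, not_or] at hz
  cases H with
  | base _ hr ha =>
    refine .base (by simp) ?_ ?_
    · simp only [Finset.mem_insert, not_or]
      exact ⟨fun h => hz.1 (by simp [h]), hr⟩
    · simpa using ⟨hzh, ha⟩
  | step H hp hne hd ha hc =>
    refine .step H hp (by simp) ?_ ?_ ?_
    · rw [Finset.disjoint_insert_right]
      exact ⟨hz.1, hd⟩
    · simpa using ⟨hzh, ha⟩
    · intro w hw
      rcases Finset.mem_insert.1 hw with rfl | hw
      · refine .step (by simp) hzv ?_
        rw [Finset.erase_insert hz.2]
        exact hc v hv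
      · exact (hc w hw).mono (Finset.subset_insert _ _)

/-- The first two statements bound the pebbles needed on the ball `S ∪ L` of radius `i`. In the last
one there is one pebble less, but one pebble of the stack on `x` may be replaced by one on `y`. -/
structure BallSolvable (G : SimpleGraph V) (r : V) (i : ℕ) (S L : Finset V) : Prop where
  of_stack : ∀ (t : ℕ) (C : V → ℕ), ∀ x ∈ L, t * 2 ^ i ≤ C x → Sol G r t C
  of_card : ∀ (t : ℕ) (C : V → ℕ),
    t * 2 ^ i + (S ∪ L).card ≤ ∑ w ∈ S ∪ L, C w + 2 * i → Sol G r t C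
  of_two : ∀ (t : ℕ) (C C₁ C₂ : V → ℕ), 1 ≤ t → ∀ x ∈ L, ∀ y ∈ L, x ≠ y →
    (S ∪ L).card ≤ ∑ w ∈ S ∪ L, C w + 2 * i →
    (∀ w ∈ S ∪ L, C w + (if w = x then t * 2 ^ i - 1 else 0) ≤ C₁ w) →
    (∀ w ∈ S ∪ L, C w + (if w = x then t * 2 ^ i - 2 else 0) + (if w = y then 1 else 0) ≤ C₂ w) →
    Sol G r t C₁ ∨ Sol G r t C₂

/-- If every configuration with few pebbles on `p` and few pairs on `L` is excluded by `N`, then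
the alternatives in `BallSolvable.of_two` leave at most one pebble on each vertex of `L`. -/
theorem pairs_of_two {L : Finset V} {C C₁ C₂ : V → ℕ} {x y p : V} {N : ℕ} (hN : 1 ≤ N)
    (hx : x ∈ L) (hy : y ∈ L) (hxy : x ≠ y)
    (h₁ : ∀ w ∈ L, C w + (if w = x then 2 * N - 1 else 0) ≤ C₁ w)
    (h₂ : ∀ w ∈ L, C w + (if w = x then 2 * N - 2 else 0) + (if w = y then 1 else 0) ≤ C₂ w)
    (hk₁ : C₁ p + ∑ z ∈ L, C₁ z / 2 < N) (hk₂ : C₂ p + ∑ z ∈ L, C₂ z / 2 < N) :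
    C₁ p = 0 ∧ C x = 0 ∧ C y = 0 ∧ N ≤ ∑ z ∈ L, C₁ z / 2 + 1 ∧ N ≤ ∑ z ∈ L, C₂ z / 2 + 1 ∧
      (∀ z ∈ L, C z ≤ 1) ∧ ∀ z ∈ L, z ≠ x → C₂ z ≤ 1 := by
  have e₁ := Finset.add_sum_erase L (fun z => C₁ z / 2) hx
  have e₂ := Finset.add_sum_erase L (fun z => C₂ z / 2) hx
  have b₁ : 2 * N - 1 + C x ≤ C₁ x := by have := h₁ x hx; simp at this; omega
  have b₂ : 2 * N - 2 + C x ≤ C₂ x := by have := h₂ x hx; simp [hxy] at this; omega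
  have b₃ : C y + 1 ≤ C₂ y := by have := h₂ y hy; simp [hxy.symm] at this; omega
  have z₁ : ∀ z ∈ L.erase x, C₁ z / 2 ≤ ∑ z ∈ L.erase x, C₁ z / 2 := fun z hz =>
    Finset.single_le_sum (f := fun z => C₁ z / 2) (fun _ _ => Nat.zero_le _) hz
  have z₂ : ∀ z ∈ L.erase x, C₂ z / 2 ≤ ∑ z ∈ L.erase x, C₂ z / 2 := fun z hz =>
    Finset.single_le_sum (f := fun z => C₂ z / 2) (fun _ _ => Nat.zero_le _) hz
  have hyx := z₂ y (Finset.mem_erase.2 ⟨hxy.symm, hy⟩)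
  refine ⟨by omega, by omega, by omega, by omega, by omega, fun z hz => ?_, fun z hz hzx => ?_⟩
  · by_cases hzx : z = x
    · subst hzx; omega
    · have := z₁ z (Finset.mem_erase.2 ⟨hzx, hz⟩)
      have := h₁ z hz
      omega
  · have := z₂ z (Finset.mem_erase.2 ⟨hzx, hz⟩)
    omega

theorem sum_erase_erase {L : Finset V} {x y : V} (hx : x ∈ L) (hy : y ∈ L) (hxy : x ≠ y)
    (C : V → ℕ) : ∑ z ∈ L, C z = C x + (C y + ∑ z ∈ (L.erase x).erase y, C z) := by
  rw [Finset.add_sum_erase _ _ (Finset.mem_erase.2 ⟨hxy.symm, hy⟩), Finset.add_sum_erase _ _ hx]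

theorem card_erase_erase {L : Finset V} {x y : V} (hx : x ∈ L) (hy : y ∈ L) (hxy : x ≠ y) :
    L.card = ((L.erase x).erase y).card + 2 := by
  have := sum_erase_erase hx hy hxy fun _ => 1
  simp only [Finset.sum_const, smul_eq_mul, mul_one] at this
  omega

theorem BallSolvable.base {L : Finset V} (hr : r ∉ L) (ha : ∀ z ∈ L, G.Adj z r) :
    BallSolvable G r 1 {r} L := by
  have key : ∀ (t : ℕ) (C : V → ℕ), t ≤ C r + ∑ z ∈ L, C z / 2 → Sol G r t C := by
    intro t C h
    obtain ⟨C', hr, hh, -⟩ := exists_reach_collect L ha C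
    exact ⟨C', hr, hh ▸ h⟩
  have hd : Disjoint {r} L := by simpa
  constructor
  · intro t C x hx h
    refine key t C ?_
    have := Finset.single_le_sum (f := fun z => C z / 2) (fun _ _ => Nat.zero_le _) hx
    omega
  · intro t C h
    refine key t C ?_
    rw [Finset.sum_union hd, Finset.card_union_of_disjoint hd, sum_eq_two_mul_add_mod L] at h
    have := sum_mod_two_le_card L C
    simp at h
    omega
  · intro t C C₁ C₂ ht x hx y hy hxy h h₁ h₂
    by_contra! hns
    rw [pow_one, mul_comm t 2] at h₁ h₂
    have hk₁ := lt_of_not_ge (mt (key t C₁) hns.1)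
    have hk₂ := lt_of_not_ge (mt (key t C₂) hns.2)
    obtain ⟨h0, hCx, hCy, -, -, h3, -⟩ := pairs_of_two ht hx hy hxy
      (fun w hw => h₁ w (Finset.mem_union_right _ hw))
      (fun w hw => h₂ w (Finset.mem_union_right _ hw)) hk₁ hk₂
    have hCr := h₁ r (by simp)
    rw [Finset.sum_union hd, Finset.card_union_of_disjoint hd, sum_erase_erase hx hy hxy,
      card_erase_erase hx hy hxy] at h
    have := sum_le_card_of_le_one (L := (L.erase x).erase y) (C := C) fun z hz =>
      h3 z (Finset.mem_of_mem_erase (Finset.mem_of_mem_erase hz))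
    simp at h
    omega

theorem BallSolvable.step {i : ℕ} {S L L' : Finset V} {p : V} (hi : 1 ≤ i)
    (H : BallSolvable G r i S L)
    (hp : p ∈ L) (hd : Disjoint (S ∪ L) L') (ha : ∀ z ∈ L', G.Adj z p)
    (hc : ∀ z ∈ L', Conn G (L.erase p) L' z) : BallSolvable G r (i + 1) (S ∪ L) L' := by
  have key : ∀ (t : ℕ) (C : V → ℕ), t * 2 ^ i ≤ C p + ∑ z ∈ L', C z / 2 → Sol G r t C := by
    intro t C h
    obtain ⟨C', hr, hh, -⟩ := exists_reach_collect L' ha C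
    exact .of_reach hr (H.of_stack t C' p hp (hh ▸ h))
  have hpS : p ∈ S ∪ L := Finset.mem_union_right _ hp
  have hY : Disjoint (L.erase p) L' :=
    hd.mono_left ((Finset.erase_subset _ _).trans Finset.subset_union_right)
  have hpow : ∀ t, t * 2 ^ (i + 1) = 2 * (t * 2 ^ i) := fun t => by ring
  have hN : ∀ t, 1 ≤ t → 2 ≤ t * 2 ^ i := fun t ht =>
    calc 2 ≤ 2 ^ i := Nat.le_self_pow (by omega) 2
      _ ≤ t * 2 ^ i := Nat.le_mul_of_pos_left _ ht
  have hcollect : ∀ C : V → ℕ, ∃ C', Reach G C C' ∧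
      ∀ w ∈ S ∪ L, C' w = C w + if w = p then ∑ z ∈ L', C z / 2 else 0 := by
    intro C
    obtain ⟨C', hr, hh, ho⟩ := exists_reach_collect L' ha C
    refine ⟨C', hr, fun w hw => ?_⟩
    split_ifs with hwp
    · rw [hwp, hh]
    · rw [ho w (Finset.disjoint_left.1 hd hw) hwp, add_zero]
  have hshift : ∀ (C : V → ℕ), ∀ z ∈ L', 2 ≤ C z → (∀ w ∈ L', w ≠ z → C w % 2 = 1) →
      ∃ y ∈ L, p ≠ y ∧ ∃ C', Reach G C C' ∧ ∀ w ∈ S ∪ L,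
        C w + (if w = p then ∑ z ∈ L', C z / 2 - 1 else 0) + (if w = y then 1 else 0) ≤ C' w := by
    intro C z hz hz2 hodd
    obtain ⟨y, hy, C', hr, ho, hs⟩ := (hc z hz).exists_reach hY hodd hz2
    obtain ⟨C'', hr', hC''⟩ := hcollect C'
    rw [Finset.mem_erase] at hy
    refine ⟨y, hy.2, hy.1.symm, C'', hr.trans hr', fun w hw => ?_⟩
    rw [hC'' w hw, ho w (Finset.disjoint_left.1 hd hw)]
    split_ifs <;> omega
  have hsum : ∀ (C : V → ℕ) (k : ℕ),
      ∑ w ∈ S ∪ L, (C w + if w = p then k else 0) = ∑ w ∈ S ∪ L, C w + k := by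
    intro C k
    rw [Finset.sum_add_distrib, Finset.sum_ite_eq' _ p, if_pos hpS]
  constructor
  · intro t C x hx h
    refine key t C ?_
    have := Finset.single_le_sum (f := fun z => C z / 2) (fun _ _ => Nat.zero_le _) hx
    rw [hpow] at h
    omega
  · intro t C h
    rcases Nat.eq_zero_or_pos t with rfl | ht
    · exact .of_le (Nat.zero_le _)
    by_contra hns
    have hk := lt_of_not_ge (mt (key t C) hns)
    rw [Finset.sum_union hd, Finset.card_union_of_disjoint hd, sum_eq_two_mul_add_mod L',
      hpow] at h
    have hm := sum_mod_two_le_card L' C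
    obtain ⟨C₁, hr₁, hC₁⟩ := hcollect C
    have hk' : ¬ t * 2 ^ i + (S ∪ L).card ≤ ∑ w ∈ S ∪ L, C₁ w + 2 * i :=
      fun h' => hns (.of_reach hr₁ (H.of_card t C₁ h'))
    rw [Finset.sum_congr rfl hC₁, hsum] at hk'
    have hodd := odd_of_card_le_sum_mod_two (L := L') (C := C) (by omega)
    have := hN t ht
    obtain ⟨z, hz, hz2⟩ := exists_pair (L := L') (C := C) (by omega)
    obtain ⟨y, hy, hpy, C₂, hr₂, hC₂⟩ := hshift C z hz hz2 fun w hw _ => hodd w hw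
    rcases H.of_two t C C₁ C₂ ht p hp y hy hpy (by omega)
      (fun w hw => by rw [hC₁ w hw]; split_ifs <;> omega)
      (fun w hw => le_trans (by split_ifs <;> omega) (hC₂ w hw)) with h' | h'
    · exact hns (.of_reach hr₁ h')
    · exact hns (.of_reach hr₂ h')
  · intro t C C₁ C₂ ht x hx y hy hxy h h₁ h₂
    by_contra! hns
    rw [hpow] at h₁ h₂
    have hk₁ := lt_of_not_ge (mt (key t C₁) hns.1)
    have hk₂ := lt_of_not_ge (mt (key t C₂) hns.2)
    have := hN t ht
    obtain ⟨-, hCx, hCy, hs₁, hs₂, h3, h4⟩ := pairs_of_two (by omega) hx hy hxy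
      (fun w hw => h₁ w (Finset.mem_union_right _ hw))
      (fun w hw => h₂ w (Finset.mem_union_right _ hw)) hk₁ hk₂
    rw [Finset.sum_union hd, Finset.card_union_of_disjoint hd, sum_erase_erase hx hy hxy,
      card_erase_erase hx hy hxy, hCx, hCy] at h
    obtain ⟨D₁, hr₁, hD₁⟩ := hcollect C₁
    have hle : ∀ w ∈ S ∪ L, C w + (if w = p then t * 2 ^ i - 1 else 0) ≤ D₁ w := by
      intro w hw
      rw [hD₁ w hw]
      have := h₁ w (Finset.mem_union_left _ hw)
      split_ifs at this ⊢ <;> omega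
    have hk' : ¬ t * 2 ^ i + (S ∪ L).card ≤ ∑ w ∈ S ∪ L, D₁ w + 2 * i :=
      fun h' => hns.1 (.of_reach hr₁ (H.of_card t D₁ h'))
    have hle' := Finset.sum_le_sum hle
    rw [hsum] at hle'
    have hsub : ∀ z ∈ (L'.erase x).erase y, C z ≤ 1 := fun z hz =>
      h3 z (Finset.mem_of_mem_erase (Finset.mem_of_mem_erase hz))
    have hcard := sum_le_card_of_le_one hsub
    have hone : ∀ z ∈ (L'.erase x).erase y, C z = 1 := by
      refine (Finset.sum_eq_sum_iff_of_le (g := fun _ => 1) hsub).1 ?_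
      simp only [Finset.sum_const, smul_eq_mul, mul_one]
      omega
    have hx2 := h₂ x (Finset.mem_union_right _ hx)
    rw [if_pos rfl, if_neg hxy] at hx2
    obtain ⟨y', hy', hpy', D₂, hr₂, hD₂⟩ := hshift C₂ x hx (by omega) fun w hw hwx => by
      have h5 := h4 w hw hwx
      have h6 := h₂ w (Finset.mem_union_right _ hw)
      by_cases hwy : w = y
      · rw [if_pos hwy] at h6; omega
      · have := hone w (by simp [hw, hwx, hwy]); omega
    rcases H.of_two t C D₁ D₂ ht p hp y' hy' hpy' (by omega) hle (fun w hw =>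
      le_trans (by
        have := h₂ w (Finset.mem_union_left _ hw)
        split_ifs at this ⊢ <;> omega) (hD₂ w hw)) with h' | h'
    · exact hns.1 (.of_reach hr₁ h')
    · exact hns.2 (.of_reach hr₂ h')

theorem Lay.ballSolvable {i : ℕ} {S L : Finset V} {h : V} (H : Lay G r i S L h) :
    BallSolvable G r i S L := by
  induction H with
  | base _ hr ha => exact .base hr ha
  | step H hp _ hd ha hc ih => exact .step H.pos ih hp hd ha hc

theorem Lay.dist_le {i : ℕ} {S L : Finset V} {h : V} (H : Lay G r i S L h) (hG : G.Connected) :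
    ∀ v ∈ S ∪ L, G.dist r v ≤ i := by
  induction H with
  | base _ _ ha =>
    intro v hv
    rcases Finset.mem_union.1 hv with hv | hv
    · simp [Finset.mem_singleton.1 hv]
    · exact (SimpleGraph.dist_eq_one_iff_adj.2 (ha v hv).symm).le
  | step _ hp _ _ ha _ ih =>
    intro v hv
    rcases Finset.mem_union.1 hv with hv | hv
    · exact (ih v hv).trans (Nat.le_succ _)
    · have h1 := ih _ (Finset.mem_union_right _ hp)
      have h2 := (SimpleGraph.dist_eq_one_iff_adj.2 (ha v hv).symm).le
      exact hG.dist_triangle.trans (Nat.add_le_add h1 h2)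

end Layers

section Strips

variable {V : Type} [DecidableEq V] {G : SimpleGraph V} {S : Finset V} {a b p q w : V}

/-- `Strip G S a b p q`: the subgraph of `G` on `S` is obtained from the edge `a b` by successively
adding vertices, each one adjacent to the two ends of the current front edge and forming the next
front edge together with one of them. The last front edge is `p q`. -/
inductive Strip (G : SimpleGraph V) : Finset V → V → V → V → V → Prop
  | edge {a b : V} : G.Adj a b → Strip G {a, b} a b a b
  | swap {S : Finset V} {a b p q : V} : Strip G S a b p q → Strip G S a b q p
  | add {S : Finset V} {a b p q w : V} : Strip G S a b p q → w ∉ S →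
      (∀ z ∈ S, G.Adj w z ↔ z = p ∨ z = q) → Strip G (insert w S) a b p w

theorem Strip.front_mem (H : Strip G S a b p q) : p ∈ S ∧ q ∈ S := by
  induction H with
  | edge => simp
  | swap _ ih => exact ih.symm
  | add _ _ _ ih => simp [ih.1]

theorem Strip.front_adj (H : Strip G S a b p q) : G.Adj p q := by
  induction H with
  | edge h => exact h
  | swap _ ih => exact ih.symm
  | add H _ h _ => exact ((h _ H.front_mem.1).2 (.inl rfl)).symm

theorem Strip.back_swap (H : Strip G S a b p q) : Strip G S b a p q := by
  induction H with
  | @edge a b h => exact Finset.pair_comm b a ▸ (Strip.edge h.symm).swap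
  | swap _ ih => exact ih.swap
  | add _ hw h ih => exact ih.add hw h

theorem Strip.back_mem (H : Strip G S a b p q) : a ∈ S ∧ b ∈ S := by
  induction H with
  | edge => simp
  | swap _ ih => exact ih
  | add _ _ _ ih => simp [ih]

theorem Strip.back_adj (H : Strip G S a b p q) : G.Adj a b := by
  induction H <;> assumption

theorem Strip.back_add (H : Strip G S a b p q) (hw : w ∉ S)
    (h : ∀ z ∈ S, G.Adj w z ↔ z = a ∨ z = b) : Strip G (insert w S) a w p q := by
  induction H with
  | @edge a b hab =>
    have h1 : G.Adj a w := ((h a (by simp)).2 (.inl rfl)).symm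
    have h2 : G.Adj b w := ((h b (by simp)).2 (.inr rfl)).symm
    have := (Strip.edge h1).add (w := b) (by simp [hab.ne', h2.ne]) (by simp [hab.symm, h2])
    convert this using 1
    ext; simp; tauto
  | swap _ ih => exact (ih hw h).swap
  | @add S a b p q v H hv hvS ih =>
    rw [Finset.mem_insert, not_or] at hw
    have hab := H.back_mem
    have hpq := H.front_mem
    have hvw : ¬ G.Adj w v := fun hwv => by
      rcases (h v (by simp)).1 hwv with rfl | rfl
      · exact hv hab.1
      · exact hv hab.2
    rw [Finset.insert_comm]
    refine (ih hw.2 fun z hz => h z (Finset.mem_insert_of_mem hz)).add ?_ fun z hz => ?_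
    · simpa using ⟨Ne.symm hw.1, hv⟩
    · rcases Finset.mem_insert.1 hz with rfl | hz
      · refine ⟨fun h => absurd h.symm hvw, ?_⟩
        rintro (rfl | rfl)
        · exact absurd hpq.1 hw.2
        · exact absurd hpq.2 hw.2
      · exact hvS z hz

theorem Strip.reverse (H : Strip G S a b p q) : Strip G S p q a b := by
  induction H with
  | edge h => exact .edge h
  | swap _ ih => exact ih.back_swap
  | add _ hw h ih => exact ih.back_add hw h

theorem Strip.eq_pair_or (H : Strip G S a b p q) : S = {a, b} ∨
    ∃ S₀ w p₀ q₀, Strip G S₀ a b p₀ q₀ ∧ w ∉ S₀ ∧ (∀ z ∈ S₀, G.Adj w z ↔ z = p₀ ∨ z = q₀) ∧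
      S = insert w S₀ ∧ (w = p ∨ w = q) := by
  induction H with
  | edge => exact .inl rfl
  | swap _ ih =>
    refine ih.imp_right ?_
    rintro ⟨S₀, w, p₀, q₀, H, hw, h, hS, hpq⟩
    exact ⟨S₀, w, p₀, q₀, H, hw, h, hS, hpq.symm⟩
  | add H hw h _ => exact .inr ⟨_, _, _, _, H, hw, h, rfl, .inr rfl⟩

theorem Strip.map {W : Type} [DecidableEq W] {G' : SimpleGraph W} (f : G ↪g G')
    (H : Strip G S a b p q) : Strip G' (S.map f.toEmbedding) (f a) (f b) (f p) (f q) := by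
  induction H with
  | edge h =>
    rw [Finset.map_insert, Finset.map_singleton]
    exact .edge (f.map_adj_iff.2 h)
  | swap _ ih => exact ih.swap
  | @add S a b p q w H hw h ih =>
    rw [Finset.map_insert]
    refine ih.add (by simpa using hw) ?_
    simpa using h

theorem Strip.reachable (H : Strip G S a b p q) : ∀ z ∈ S, G.Reachable a z := by
  induction H with
  | edge h => simpa using h.reachable
  | swap _ ih => exact ih
  | add H hw h ih =>
    intro z hz
    rcases Finset.mem_insert.1 hz with rfl | hz
    · have hp := H.front_mem.1
      exact (ih _ hp).trans ((h _ hp).2 (.inl rfl)).symm.reachable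
    · exact ih z hz

theorem Strip.connected [Fintype V] (H : Strip G Finset.univ a b p q) : G.Connected :=
  (SimpleGraph.connected_iff_exists_forall_reachable G).2
    ⟨a, fun z => H.reachable z (Finset.mem_univ z)⟩

theorem Strip.exists_front {x y : V} (H : Strip G S a b p q) (hw : w ∉ S)
    (h : ∀ z ∈ S, G.Adj w z ↔ z = p ∨ z = q) (hx : x ∈ insert w S) (hy : y ∈ insert w S)
    (hxy : G.Adj x y) (hwxy : w = x ∨ w = y) : ∃ a b, Strip G (insert w S) a b x y := by
  have key : ∀ z ∈ insert w S, G.Adj w z → Strip G (insert w S) a b z w := by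
    intro z hz hwz
    rcases (h z (Finset.mem_of_mem_insert_of_ne hz hwz.ne')).1 hwz with rfl | rfl
    · exact H.add hw h
    · exact H.swap.add hw fun z hz => (h z hz).trans or_comm
  rcases hwxy with rfl | rfl
  · exact ⟨a, b, (key y hy hxy).swap⟩
  · exact ⟨a, b, key x hx hxy.symm⟩

theorem Strip.isSimplicial [Fintype V] {v : V} (H : Strip G S a b p q)
    (h : ∀ z ∈ S, G.Adj w z ↔ z = p ∨ z = q) (hS : insert w S = Finset.univ.erase v)
    (hv : ¬ G.Adj w v) : IsSimplicial G w := by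
  have key : ∀ z, G.Adj w z → z = p ∨ z = q := by
    intro z hz
    have hzS : z ∈ insert w S := by
      rw [hS, Finset.mem_erase]
      exact ⟨fun h => hv (h ▸ hz), Finset.mem_univ z⟩
    exact (h z (Finset.mem_of_mem_insert_of_ne hzS hz.ne')).1 hz
  intro x y hx hy hxy
  have := H.front_adj
  rcases key x hx with rfl | rfl <;> rcases key y hy with rfl | rfl
  · exact absurd rfl hxy
  · exact this
  · exact this.symm
  · exact absurd rfl hxy

theorem exists_strip_of_extend [Fintype V] {u v : V}
    (hs : {w : V | IsSimplicial G w} = {u, v}) (hN : (G.neighborSet v).ncard = 2)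
    (hv : IsSimplicial G v) (H : Strip G (Finset.univ.erase v) a b p q) :
    ∃ a b p q, Strip G Finset.univ a b p q := by
  obtain ⟨x, y, hxy, hNv⟩ := Set.ncard_eq_two.1 hN
  have hadj : ∀ z, G.Adj v z ↔ z = x ∨ z = y := fun z => by
    rw [← SimpleGraph.mem_neighborSet, hNv]; simp
  have hvx := (hadj x).2 (.inl rfl)
  have hvy := (hadj y).2 (.inr rfl)
  have hxy' := hv x y hvx hvy hxy
  have hx : x ∈ Finset.univ.erase v := by simp [hvx.ne']
  have hy : y ∈ Finset.univ.erase v := by simp [hvy.ne']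
  suffices ∃ a b, Strip G (Finset.univ.erase v) a b x y by
    obtain ⟨a, b, H⟩ := this
    refine ⟨a, b, x, v, ?_⟩
    rw [← Finset.insert_erase (Finset.mem_univ v)]
    exact H.add (by simp) fun z _ => hadj z
  have hpair : ∀ a b : V, Finset.univ.erase v = {a, b} →
      ∃ a b, Strip G (Finset.univ.erase v) a b x y := by
    intro a b h
    have : Finset.univ.erase v = {x, y} := by
      refine (Finset.eq_of_subset_of_card_le (by simp [Finset.insert_subset_iff, hvx.ne', hvy.ne'])
        ?_).symm
      rw [h, Finset.card_pair hxy]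
      exact Finset.card_le_two
    exact ⟨x, y, this ▸ .edge hxy'⟩
  rcases H.eq_pair_or with h | ⟨S₀, w, p₀, q₀, H₀, hw, h₀, hS, hwpq⟩
  · exact hpair a b h
  rcases H.reverse.eq_pair_or with h | ⟨S₁, w', p₁, q₁, H₁, hw', h₁, hS', -⟩
  · exact hpair p q h
  by_cases hwxy : w = x ∨ w = y
  · rw [hS] at hx hy ⊢
    exact H₀.exists_front hw h₀ hx hy hxy' hwxy
  by_cases hwxy' : w' = x ∨ w' = y
  · rw [hS'] at hx hy ⊢
    exact H₁.exists_front hw' h₁ hx hy hxy' hwxy'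
  have key : ∀ z ∈ Finset.univ.erase v, IsSimplicial G z → z = u := by
    intro z hz hsz
    have : z ∈ ({u, v} : Set V) := hs ▸ hsz
    rcases this with h | h
    · exact h
    · exact absurd h (Finset.ne_of_mem_erase hz)
  have hwu := key w (hS ▸ Finset.mem_insert_self _ _)
    (H₀.isSimplicial h₀ hS.symm fun h => hwxy ((hadj w).1 h.symm))
  have hwu' := key w' (hS' ▸ Finset.mem_insert_self _ _)
    (H₁.isSimplicial h₁ hS'.symm fun h => hwxy' ((hadj w').1 h.symm))
  have hww : w' = w := hwu'.trans hwu.symm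
  rcases hwpq with h | h
  · exact absurd (hww.trans h ▸ H₁.back_mem.1) hw'
  · exact absurd (hww.trans h ▸ H₁.back_mem.2) hw'

end Strips

theorem exists_strip {V : Type} {G : SimpleGraph V} (hG : IsTwoPath G) [Fintype V]
    [DecidableEq V] : ∃ a b p q, Strip G Finset.univ a b p q := by
  rename_i i₁ i₂
  induction hG generalizing i₁ i₂ with
  | complete2 G hc h =>
    rw [Nat.card_eq_fintype_card, ← Finset.card_univ, Finset.card_eq_two] at hc
    obtain ⟨x, y, hxy, hu⟩ := hc
    exact ⟨x, y, x, y, hu ▸ .edge (h x y hxy)⟩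
  | complete3 G hc h =>
    rw [Nat.card_eq_fintype_card, ← Finset.card_univ, Finset.card_eq_three] at hc
    obtain ⟨x, y, z, hxy, hxz, hyz, hu⟩ := hc
    refine ⟨y, z, y, x, hu ▸ (Strip.edge (h y z hyz)).add (by simp [hxy, hxz]) fun w hw => ?_⟩
    rw [Finset.mem_insert, Finset.mem_singleton] at hw
    refine ⟨fun _ => hw, fun _ => h x w ?_⟩
    rcases hw with rfl | rfl <;> assumption
  | @extend V G u v huv hs hN hv _ ih =>
    obtain ⟨a, b, p, q, H⟩ := @ih (Subtype.fintype _) inferInstance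
    have := H.map (SimpleGraph.Embedding.induce _)
    refine exists_strip_of_extend hs hN hv (a := a.1) (b := b.1) (p := p.1) (q := q.1) ?_
    suffices h : Finset.univ.erase v =
        Finset.univ.map (SimpleGraph.Embedding.induce (G := G) {w | w ≠ v}).toEmbedding by
      rw [h]
      exact this
    ext z
    simp [eq_comm]

section Splitting

variable {V : Type} [DecidableEq V] {G : SimpleGraph V} {S B : Finset V} {a b p q r c : V}

/-- Every strip splits at each of its vertices `r` into two strips with a common back edge. -/
theorem Strip.split (H : Strip G S a b p q) (hr : r ∈ S) :
    ∃ c p' q' A B, Strip G A r c p' q' ∧ Strip G B r c p q ∧ A ∪ B = S ∧ A ∩ B = {r, c} ∧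
      ∀ u ∈ A, ∀ v ∈ B, G.Adj u v → u ∈ B ∨ v ∈ A := by
  induction H with
  | @edge a b h =>
    rw [Finset.mem_insert, Finset.mem_singleton] at hr
    rcases hr with rfl | rfl
    · exact ⟨b, r, b, _, _, .edge h, .edge h, by simp, by simp, fun u hu _ _ _ => .inl hu⟩
    · refine ⟨a, a, r, _, _, (Strip.edge h).back_swap, (Strip.edge h).back_swap, by simp,
        by simp [Finset.pair_comm], fun u hu _ _ _ => .inl hu⟩
  | swap _ ih =>
    obtain ⟨c, p', q', A, B, HA, HB, h⟩ := ih hr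
    exact ⟨c, p', q', A, B, HA, HB.swap, h⟩
  | @add S a b p q w H hw h ih =>
    have hwp : G.Adj w p := (h p H.front_mem.1).2 (.inl rfl)
    by_cases hrw : r = w
    · subst hrw
      have hsub : ({r, p} : Finset V) ⊆ insert r S := by
        simp [Finset.insert_subset_iff, H.front_mem.1]
      exact ⟨p, a, b, insert r S, {r, p}, (H.add hw h).reverse.back_swap, (Strip.edge hwp).swap,
        Finset.union_eq_left.2 hsub, Finset.inter_eq_right.2 hsub, fun _ _ _ hv _ => .inr (hsub hv)⟩
    · obtain ⟨c, p', q', A, B, HA, HB, hU, hI, hE⟩ := ih (Finset.mem_of_mem_insert_of_ne hr hrw)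
      have hwA : w ∉ A := fun h => hw (hU ▸ Finset.mem_union_left _ h)
      have hwB : w ∉ B := fun h => hw (hU ▸ Finset.mem_union_right _ h)
      refine ⟨c, p', q', A, insert w B, HA, HB.add hwB fun z hz => h z ?_, ?_, ?_, ?_⟩
      · exact hU ▸ Finset.mem_union_right _ hz
      · rw [Finset.union_insert, hU]
      · rw [Finset.inter_insert_of_notMem hwA, hI]
      · intro u hu v hv huv
        rcases Finset.mem_insert.1 hv with rfl | hv
        · left
          refine Finset.mem_insert_of_mem ?_
          rcases (h u (hU ▸ Finset.mem_union_left _ hu)).1 huv.symm with rfl | rfl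
          · exact HB.front_mem.1
          · exact HB.front_mem.2
        · exact (hE u hu v hv huv).imp_left (Finset.mem_insert_of_mem ·)

theorem Strip.conn (H : Strip G S r c p q) : ∀ z ∈ S \ {r, c}, Conn G {r} (S \ {r, c}) z := by
  generalize hr : r = r' at H
  generalize hc : c = c' at H
  induction H with
  | edge => subst hr hc; simp
  | swap _ ih => exact ih hr hc
  | @add S a b p q w H hw h ih =>
    subst hr hc
    intro z hz
    have hwrc : w ≠ r ∧ w ≠ c := by
      have := H.back_mem
      constructor <;> (rintro rfl; simp_all)
    have hS : insert w S \ {r, c} = insert w (S \ {r, c}) :=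
      Finset.insert_sdiff_of_notMem _ (by simp [hwrc])
    have hne := H.front_adj.ne
    rw [hS] at hz ⊢
    rcases Finset.mem_insert.1 hz with rfl | hz
    · have key : ∀ x ∈ S, x ≠ c → G.Adj z x → Conn G {r} (insert z (S \ {r, c})) z := by
        intro x hx hxc hzx
        by_cases hxr : x = r
        · exact .base (Finset.mem_insert_self _ _) (Finset.mem_singleton_self _) (hxr ▸ hzx)
        · refine .step (Finset.mem_insert_self _ _) hzx ?_
          rw [Finset.erase_insert (by simp [hw])]
          exact ih rfl rfl x (by simp [hx, hxc, hxr])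
      by_cases hpc : p = c
      · exact key q H.front_mem.2 (fun h => hne (hpc.trans h.symm))
          ((h q H.front_mem.2).2 (.inr rfl))
      · exact key p H.front_mem.1 hpc ((h p H.front_mem.1).2 (.inl rfl))
    · exact (ih rfl rfl z hz).mono (Finset.subset_insert _ _)

/-- A layering of the set `B` around `r`: `δ` gives the indices of the layers, and `Z` contains all
vertices that have a neighbour of larger index. -/
structure Layering (G : SimpleGraph V) (B : Finset V) (r c : V) (i : ℕ) (L : Finset V)
    (h : V) (δ : V → ℕ) (Z : Finset V) : Prop where
  exists_lay : ∃ S, B = S ∪ L ∧ Lay G r i S L h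
  δ_root : δ r = 0
  δ_snd : δ c = 1
  δ_eq : ∀ v ∈ L, δ v = i
  δ_le : ∀ v ∈ B, δ v ≤ i
  δ_adj : ∀ u ∈ B, ∀ v ∈ B, G.Adj u v → δ u ≤ δ v + 1
  root_mem : r ∈ Z
  hub_mem : h ∈ Z
  δ_hub : δ h + 1 = i
  card_le : Z.card + 1 ≤ 2 * i
  mem_of_adj : ∀ u ∈ B, ∀ v ∈ B, G.Adj u v → δ v < δ u → v ∈ Z

theorem Layering.step {i : ℕ} {L Z : Finset V} {δ : V → ℕ} {h w : V}
    (HL : Layering G B r c i L h δ Z) (hr : r ∈ B) (hc : c ∈ B) (hp : p ∈ L) (hq : q ∈ L)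
    (hpq : p ≠ q) (hw : w ∉ B) (hN : ∀ z ∈ B, G.Adj w z ↔ z = p ∨ z = q) :
    Layering G (insert w B) r c (i + 1) {w} p (Function.update δ w (i + 1))
      (insert p (insert q Z)) := by
  obtain ⟨S, hB, HLay⟩ := HL.exists_lay
  have hLB : L ⊆ B := hB ▸ Finset.subset_union_right
  have hwp := (hN p (hLB hp)).2 (.inl rfl)
  have hwq := (hN q (hLB hq)).2 (.inr rfl)
  have hδ : ∀ v ∈ B, Function.update δ w (i + 1) v = δ v := fun v hv =>
    Function.update_of_ne (ne_of_mem_of_not_mem hv hw) _ _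
  refine ⟨⟨B, by rw [Finset.union_comm]; rfl, ?_⟩, ?_, ?_, ?_, ?_, ?_, ?_, ?_, ?_, ?_, ?_⟩
  · subst hB
    refine HLay.step hp (by simp) (by simpa using hw) (by simpa using hwp) ?_
    simp only [Finset.mem_singleton, forall_eq]
    exact .base (by simp) (Finset.mem_erase.2 ⟨hpq.symm, hq⟩) hwq
  · rw [hδ r hr, HL.δ_root]
  · rw [hδ c hc, HL.δ_snd]
  · simp
  · intro v hv
    rcases Finset.mem_insert.1 hv with rfl | hv
    · simp
    · rw [hδ v hv]; exact (HL.δ_le v hv).trans (Nat.le_succ _)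
  · intro u hu v hv huv
    rcases Finset.mem_insert.1 hu with rfl | hu' <;>
      rcases Finset.mem_insert.1 hv with rfl | hv'
    · exact absurd rfl huv.ne
    · have : v ∈ L := by rcases (hN v hv').1 huv with rfl | rfl <;> assumption
      rw [Function.update_self, hδ v hv', HL.δ_eq v this]
    · rw [Function.update_self, hδ u hu']
      have := HL.δ_le u hu'
      omega
    · rw [hδ u hu', hδ v hv']; exact HL.δ_adj u hu' v hv' huv
  · simp [HL.root_mem]
  · simp
  · rw [hδ p (hLB hp), HL.δ_eq p hp]
  · have h1 := Finset.card_insert_le p (insert q Z)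
    have h2 := Finset.card_insert_le q Z
    have := HL.card_le
    omega
  · intro u hu v hv huv hlt
    rcases Finset.mem_insert.1 hu with rfl | hu' <;>
      rcases Finset.mem_insert.1 hv with rfl | hv'
    · exact absurd rfl huv.ne
    · rcases (hN v hv').1 huv with rfl | rfl <;> simp
    · rw [Function.update_self, hδ u hu'] at hlt
      have := HL.δ_le u hu'
      omega
    · rw [hδ u hu', hδ v hv'] at hlt
      simp [HL.mem_of_adj u hu' v hv' huv hlt]

theorem Layering.extend {i : ℕ} {L Z : Finset V} {δ : V → ℕ} {h w : V}
    (HL : Layering G B r c i L h δ Z) (hr : r ∈ B) (hc : c ∈ B) (hq : q ∈ L) (hw : w ∉ B)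
    (hN : ∀ z ∈ B, G.Adj w z ↔ z = h ∨ z = q) :
    Layering G (insert w B) r c i (insert w L) h (Function.update δ w i) Z := by
  obtain ⟨S, hB, HLay⟩ := HL.exists_lay
  have hLB : L ⊆ B := hB ▸ Finset.subset_union_right
  have hhB : h ∈ B := hB ▸ Finset.mem_union_left _ HLay.hub_mem
  have hwh := (hN h hhB).2 (.inl rfl)
  have hwq := (hN q (hLB hq)).2 (.inr rfl)
  have hδ : ∀ v ∈ B, Function.update δ w i v = δ v := fun v hv =>
    Function.update_of_ne (ne_of_mem_of_not_mem hv hw) _ _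
  refine ⟨⟨S, by rw [hB, Finset.union_insert], ?_⟩, ?_, ?_, ?_, ?_, ?_, HL.root_mem, HL.hub_mem,
    ?_, HL.card_le, ?_⟩
  · subst hB
    exact HLay.insert hq hw hwh hwq
  · rw [hδ r hr, HL.δ_root]
  · rw [hδ c hc, HL.δ_snd]
  · intro v hv
    rcases Finset.mem_insert.1 hv with rfl | hv
    · simp
    · rw [hδ v (hLB hv), HL.δ_eq v hv]
  · intro v hv
    rcases Finset.mem_insert.1 hv with rfl | hv
    · simp
    · rw [hδ v hv]; exact HL.δ_le v hv
  · intro u hu v hv huv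
    rcases Finset.mem_insert.1 hu with rfl | hu' <;>
      rcases Finset.mem_insert.1 hv with rfl | hv'
    · exact absurd rfl huv.ne
    · rw [Function.update_self, hδ v hv']
      rcases (hN v hv').1 huv with rfl | rfl
      · exact HL.δ_hub.ge
      · rw [HL.δ_eq v hq]; omega
    · rw [Function.update_self, hδ u hu']
      exact (HL.δ_le u hu').trans (Nat.le_succ _)
    · rw [hδ u hu', hδ v hv']; exact HL.δ_adj u hu' v hv' huv
  · rw [hδ h hhB, HL.δ_hub]
  · intro u hu v hv huv hlt
    rcases Finset.mem_insert.1 hu with rfl | hu' <;>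
      rcases Finset.mem_insert.1 hv with rfl | hv'
    · exact absurd rfl huv.ne
    · rcases (hN v hv').1 huv with rfl | rfl
      · exact HL.hub_mem
      · rw [Function.update_self, hδ v hv', HL.δ_eq v hq] at hlt
        omega
    · rw [Function.update_self, hδ u hu'] at hlt
      have := HL.δ_le u hu'
      omega
    · rw [hδ u hu', hδ v hv'] at hlt
      exact HL.mem_of_adj u hu' v hv' huv hlt

theorem Strip.exists_layering (H : Strip G B r c p q) :
    ∃ i L h δ Z, Layering G B r c i L h δ Z ∧
      (p ∈ L ∧ q ∈ L ∨ p = h ∧ q ∈ L ∨ p ∈ L ∧ q = h) := by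
  induction H with
  | @edge r c ha =>
    refine ⟨1, {c}, r, fun v => if v = r then 0 else 1, {r}, ⟨⟨{r}, rfl, ?_⟩, ?_, ?_, ?_, ?_, ?_,
      ?_, ?_, ?_, ?_, ?_⟩, .inr (.inl ⟨rfl, by simp⟩)⟩
    · exact .base (by simp) (by simpa using ha.ne) (by simpa using ha.symm)
    · simp
    · simp [ha.ne']
    · simp [ha.ne']
    · intro v _; split_ifs <;> omega
    · intro u _ v _ _; split_ifs <;> omega
    · simp
    · simp
    · simp
    · simp
    · intro u _ v _ _ hlt
      split_ifs at hlt with h1 h2 <;> simp_all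
  | swap _ ih =>
    obtain ⟨i, L, h, δ, Z, HL, hf⟩ := ih
    exact ⟨i, L, h, δ, Z, HL, by tauto⟩
  | @add S a b p q w H hw hN ih =>
    obtain ⟨i, L, h, δ, Z, HL, hf⟩ := ih
    rcases hf with ⟨hp, hq⟩ | ⟨rfl, hq⟩ | ⟨hp, rfl⟩
    · exact ⟨_, _, _, _, _, HL.step H.back_mem.1 H.back_mem.2 hp hq H.front_adj.ne hw hN, by simp⟩
    · exact ⟨_, _, _, _, _, HL.extend H.back_mem.1 H.back_mem.2 hq hw hN, by simp⟩
    · exact ⟨_, _, _, _, _, HL.extend H.back_mem.1 H.back_mem.2 hp hw fun z hz =>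
        (hN z hz).trans or_comm, by simp [hp]⟩

end Splitting

section Distance

variable {V : Type} {G : SimpleGraph V}

theorem le_add_dist (hG : G.Connected) {f : V → ℕ} (hf : ∀ u v, G.Adj u v → f u ≤ f v + 1)
    (u v : V) : f u ≤ f v + G.dist v u := by
  obtain ⟨p, hp⟩ := hG.exists_walk_length_eq_dist v u
  rw [← hp]
  clear hp
  induction p with
  | nil => simp
  | cons h p ih =>
    have := hf _ _ h.symm
    rw [SimpleGraph.Walk.length_cons]
    omega

theorem dist_le_diam [Finite V] (hG : G.Connected) (u v : V) : G.dist u v ≤ G.diam :=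
  have := hG.nonempty
  SimpleGraph.dist_le_diam (SimpleGraph.connected_iff_ediam_ne_top.1 hG)

end Distance

theorem mul_two_pow_add_le {t β D : ℕ} (ht : 1 ≤ t) (hβ : 1 ≤ β) (h : β ≤ D) :
    t * 2 ^ β + 2 * D ≤ t * 2 ^ D + 2 * β := by
  induction D, h using Nat.le_induction with
  | base => rfl
  | succ D hD ih =>
    have h1 : 2 ≤ 2 ^ D := Nat.le_self_pow (by omega) 2
    have h2 : 2 ^ D ≤ t * 2 ^ D := Nat.le_mul_of_pos_left _ ht
    have h3 : t * 2 ^ (D + 1) = 2 * (t * 2 ^ D) := by ring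
    omega

section Bounds

variable {V : Type} [DecidableEq V] {G : SimpleGraph V} {A B L Z : Finset V} {r c h : V}
  {i : ℕ} {δ : V → ℕ}

theorem Lay.adj_root {S : Finset V} (H : Lay G r 1 S L h) : ∀ z ∈ S ∪ L, z ≠ r → G.Adj z r := by
  generalize hi : 1 = i at H
  cases H with
  | base _ _ ha =>
    intro z hz hzr
    rcases Finset.mem_union.1 hz with hz | hz
    · exact absurd (Finset.mem_singleton.1 hz) hzr
    · exact ha z hz
  | step H =>
    have := H.pos
    omega

theorem Layering.pos (HL : Layering G B r c i L h δ Z) : 1 ≤ i := by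
  have := HL.δ_hub
  omega

theorem Layering.exists_mem (HL : Layering G B r c i L h δ Z) : ∃ w ∈ B, w ∈ L := by
  obtain ⟨S, rfl, H⟩ := HL.exists_lay
  obtain ⟨w, hw⟩ := H.nonempty
  exact ⟨w, Finset.mem_union_right _ hw, hw⟩

theorem Layering.adj_root (HL : Layering G B r c i L h δ Z) (hi : i ≤ 1) :
    ∀ z ∈ B, z ≠ r → G.Adj z r := by
  obtain ⟨S, rfl, H⟩ := HL.exists_lay
  obtain rfl : i = 1 := le_antisymm hi HL.pos
  exact H.adj_root

theorem Layering.dist_le (HL : Layering G B r c i L h δ Z) (hG : G.Connected) :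
    ∀ v ∈ B, G.dist r v ≤ i := by
  obtain ⟨S, rfl, H⟩ := HL.exists_lay
  exact H.dist_le hG

theorem Layering.sol (HL : Layering G B r c i L h δ Z) {t : ℕ} {C : V → ℕ}
    (hC : t * 2 ^ i + B.card ≤ ∑ w ∈ B, C w + 2 * i) : Sol G r t C := by
  obtain ⟨S, rfl, H⟩ := HL.exists_lay
  exact H.ballSolvable.of_card t C hC

/-- The index function of a layering of `B`, extended by `1`. -/
def extendIndex (B : Finset V) (δ : V → ℕ) (v : V) : ℕ := if v ∈ B then δ v else 1

theorem Layering.extendIndex_le (HL : Layering G B r c i L h δ Z) (v : V) :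
    extendIndex B δ v ≤ i := by
  unfold extendIndex
  split_ifs with hv
  · exact HL.δ_le v hv
  · exact HL.pos

/-- `A` and `B` cover the graph, meet in the edge `r c`, and are separated by it. -/
structure Split [Fintype V] (G : SimpleGraph V) (r c : V) (A B : Finset V) : Prop where
  union : A ∪ B = Finset.univ
  inter : A ∩ B = {r, c}
  adj : G.Adj r c
  mem_of_adj : ∀ u ∈ A, ∀ v ∈ B, G.Adj u v → u ∈ B ∨ v ∈ A

variable [Fintype V]

theorem Split.symm (H : Split G r c A B) : Split G r c B A :=
  ⟨by rw [Finset.union_comm, H.union], by rw [Finset.inter_comm, H.inter], H.adj,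
    fun u hu v hv huv => (H.mem_of_adj v hv u hu huv.symm).symm⟩

theorem Split.mem_left (H : Split G r c A B) {v : V} (hv : v ∉ B) : v ∈ A :=
  (Finset.mem_union.1 (H.union ▸ Finset.mem_univ v)).resolve_right hv

theorem Split.root_mem (H : Split G r c A B) : r ∈ A ∧ r ∈ B :=
  Finset.mem_inter.1 (by simp [H.inter])

theorem Split.snd_mem (H : Split G r c A B) : c ∈ A ∧ c ∈ B :=
  Finset.mem_inter.1 (by simp [H.inter])

theorem Split.eq_or_eq (H : Split G r c A B) {u v : V} (hu : u ∉ B) (hv : v ∈ B)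
    (huv : G.Adj u v) : v = r ∨ v = c := by
  have hvA := (H.mem_of_adj u (H.mem_left hu) v hv huv).resolve_left hu
  have : v ∈ A ∩ B := Finset.mem_inter.2 ⟨hvA, hv⟩
  simpa [H.inter] using this

theorem Split.mem_sdiff (H : Split G r c A B) {v : V} : v ∈ A \ {r, c} ↔ v ∉ B := by
  rw [← H.inter, Finset.mem_sdiff, Finset.mem_inter]
  have := H.mem_left (v := v)
  tauto

theorem Split.sum_eq (H : Split G r c A B) (C : V → ℕ) :
    ∑ v, C v = ∑ v ∈ A \ {r, c}, C v + ∑ v ∈ B, C v := by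
  have hd : Disjoint (A \ {r, c}) B := Finset.disjoint_left.2 fun v hv => H.mem_sdiff.1 hv
  rw [← Finset.sum_union hd]
  congr 1
  refine (Finset.eq_univ_of_forall fun v => ?_).symm
  rw [Finset.mem_union, H.mem_sdiff]
  tauto

theorem Split.card_eq (H : Split G r c A B) : Fintype.card V = (A \ {r, c}).card + B.card := by
  simpa using H.sum_eq fun _ => 1

theorem Split.card_left (H : Split G r c A B) : A.card = (A \ {r, c}).card + 2 := by
  have hsub : ({r, c} : Finset V) ⊆ A := by
    simp [Finset.insert_subset_iff, H.root_mem.1, H.snd_mem.1]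
  rw [← Finset.card_pair H.adj.ne, Finset.card_sdiff_add_card_eq_card hsub]

theorem Layering.extendIndex_adj (HL : Layering G B r c i L h δ Z) (H : Split G r c A B) {u v : V}
    (huv : G.Adj u v) :
    extendIndex B δ u ≤ extendIndex B δ v + 1 ∧
      (extendIndex B δ v < extendIndex B δ u → v ∈ Z) := by
  have hr := HL.δ_root
  have hc := HL.δ_snd
  unfold extendIndex
  split_ifs with hu hv hv
  · exact ⟨HL.δ_adj u hu v hv huv, HL.mem_of_adj u hu v hv huv⟩
  · rcases H.eq_or_eq hv hu huv.symm with rfl | rfl <;> omega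
  · rcases H.eq_or_eq hu hv huv with rfl | rfl
    · exact ⟨by omega, fun _ => HL.root_mem⟩
    · omega
  · omega

theorem Layering.le_diam (HL : Layering G B r c i L h δ Z) (H : Split G r c A B)
    (hG : G.Connected) : i ≤ G.diam := by
  obtain ⟨w, hwB, hwL⟩ := HL.exists_mem
  have := le_add_dist hG (fun u v huv => (HL.extendIndex_adj H huv).1) w r
  rw [extendIndex, extendIndex, if_pos hwB, if_pos H.root_mem.2, HL.δ_eq w hwL, HL.δ_root,
    zero_add] at this
  exact this.trans (dist_le_diam hG r w)

theorem Layering.lt_diam (HL : Layering G B r c i L h δ Z) (H : Split G r c A B)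
    (hG : G.Connected) {u : V} (hu : u ∉ B) (hur : ¬ G.Adj u r) (huc : ¬ G.Adj u c) :
    i < G.diam := by
  classical
  let f : V → ℕ := fun v =>
    if v ∈ B then max 2 (δ v + 1) else if v = u then 0 else if G.Adj u v then 1 else 2
  have hf : ∀ v w, G.Adj v w → f v ≤ f w + 1 := by
    intro v w hvw
    have hr := HL.δ_root
    have hc := HL.δ_snd
    by_cases hv : v ∈ B <;> by_cases hw : w ∈ B
    · have := HL.δ_adj v hv w hw hvw
      simp only [f, if_pos hv, if_pos hw]
      omega
    · have hwu : w ≠ u := by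
        rintro rfl
        rcases H.eq_or_eq hw hv hvw.symm with rfl | rfl
        · exact hur hvw.symm
        · exact huc hvw.symm
      simp only [f, if_pos hv, if_neg hw, if_neg hwu]
      rcases H.eq_or_eq hw hv hvw.symm with rfl | rfl <;> split_ifs <;> omega
    · simp only [f, if_neg hv, if_pos hw]
      split_ifs <;> omega
    · simp only [f, if_neg hv, if_neg hw]
      by_cases hwu : w = u
      · rw [if_pos (show G.Adj u v from hwu ▸ hvw.symm)]
        split_ifs <;> omega
      · rw [if_neg hwu]
        split_ifs <;> omega
  obtain ⟨w, hwB, hwL⟩ := HL.exists_mem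
  have h1 := le_add_dist hG hf w u
  have h2 := dist_le_diam hG u w
  simp only [f, if_pos hwB, if_neg hu, if_pos, HL.δ_eq w hwL] at h1
  omega

/-- The configuration with `t * 2 ^ D - 1` pebbles on a vertex `w` of the last layer, none on the
other vertices of `Z`, and one on each remaining vertex is not solvable. -/
theorem Layering.exists_not_sol (HL : Layering G B r c i L h δ Z) (H : Split G r c A B) {t : ℕ}
    (ht : 1 ≤ t) :
    ∃ C, t * 2 ^ i + Fintype.card V ≤ ∑ v, C v + 2 * i + 1 ∧ ¬ Sol G r t C := by
  obtain ⟨w, hwB, hwL⟩ := HL.exists_mem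
  have hf := fun u v (huv : G.Adj u v) => HL.extendIndex_adj H huv
  have hfi := HL.extendIndex_le
  have hfr : extendIndex B δ r = 0 := by rw [extendIndex, if_pos H.root_mem.2, HL.δ_root]
  have hfw : extendIndex B δ w = i := by rw [extendIndex, if_pos hwB, HL.δ_eq w hwL]
  generalize extendIndex B δ = f at *
  let φ : (V → ℕ) → V → ℕ := fun C v =>
    2 ^ (i - f v) * if v ∈ insert w Z then C v else 2 * (C v / 2)
  have hstep : ∀ C C', PebblingStep G C C' → ∑ v, φ C' v ≤ ∑ v, φ C v := by
    intro C C' hs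
    obtain ⟨u, v, E, huv, rfl, rfl⟩ := exists_eq_add_single hs
    have h1 : ∀ x, φ (E + Pi.single u 2) x =
        φ E x + if x = u then 2 * 2 ^ (i - f u) else 0 := by
      intro x
      by_cases hx : x = u
      · subst hx
        simp only [φ, Pi.add_apply, Pi.single_eq_same, if_true]
        split_ifs
        · ring
        · rw [Nat.add_div_right _ (by norm_num)]
          ring
      · simp [φ, hx]
    have h2 : ∀ x, φ (E + Pi.single v 1) x ≤
        φ E x + if x = v then 2 * 2 ^ (i - f u) else 0 := by
      intro x
      by_cases hx : x = v
      · subst hx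
        have hux := hf u x huv
        simp only [φ, Pi.add_apply, Pi.single_eq_same, if_true]
        split_ifs with hxZ
        · rw [mul_add, mul_one]
          refine Nat.add_le_add_left ?_ _
          rw [← pow_succ']
          exact Nat.pow_le_pow_right (by norm_num) (by omega)
        · have hle : f u ≤ f x := by
            by_contra! hlt
            exact hxZ (Finset.mem_insert_of_mem (hux.2 hlt))
          have hpow : 2 ^ (i - f x) ≤ 2 ^ (i - f u) :=
            Nat.pow_le_pow_right (by norm_num) (by omega)
          have hdiv : 2 * ((E x + 1) / 2) ≤ 2 * (E x / 2) + 2 := by omega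
          calc _ ≤ 2 ^ (i - f x) * (2 * (E x / 2) + 2) := Nat.mul_le_mul_left _ hdiv
            _ = 2 ^ (i - f x) * (2 * (E x / 2)) + 2 * 2 ^ (i - f x) := by ring
            _ ≤ _ := by omega
      · simp [φ, hx]
    refine (Finset.sum_le_sum fun x _ => h2 x).trans ?_
    rw [Finset.sum_congr rfl fun x _ => h1 x]
    simp [Finset.sum_add_distrib]
  have hreach : ∀ C C', Reach G C C' → ∑ v, φ C' v ≤ ∑ v, φ C v := by
    intro C C' hr
    induction hr with
    | refl => exact le_rfl
    | tail _ hs ih => exact (hstep _ _ hs).trans ih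
  have hN : 1 ≤ t * 2 ^ i := Nat.mul_pos ht (by positivity)
  let C : V → ℕ := fun v => if v = w then t * 2 ^ i - 1 else if v ∈ Z then 0 else 1
  refine ⟨C, ?_, ?_⟩
  · have h1 : ∑ v, (1 + if v = w then t * 2 ^ i - 1 else 0) ≤
        ∑ v, (C v + if v ∈ insert w Z then 1 else 0) := by
      refine Finset.sum_le_sum fun v _ => ?_
      by_cases hv : v = w
      · simp [C, hv]; omega
      · by_cases hvZ : v ∈ Z <;> simp [C, hv, hvZ]
    have h2 := Finset.card_insert_le w Z
    have h3 := HL.card_le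
    simp only [Finset.sum_add_distrib, Finset.sum_ite_eq', Finset.mem_univ, if_true,
      Finset.sum_const, smul_eq_mul, mul_one, Finset.card_univ, Finset.sum_boole, Nat.cast_id,
      Finset.filter_univ_mem] at h1
    omega
  · rintro ⟨C', hr, ht'⟩
    have h1 : ∑ v, φ C v = t * 2 ^ i - 1 := by
      rw [Finset.sum_eq_single w]
      · simp [φ, C, hfw]
      · intro v _ hv
        by_cases hvZ : v ∈ Z <;> simp [φ, C, hv, hvZ]
      · simp
    have h2 : t * 2 ^ i ≤ φ C' r := by
      simp only [φ, hfr, Nat.sub_zero, if_pos (Finset.mem_insert_of_mem HL.root_mem)]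
      rw [mul_comm]
      exact Nat.mul_le_mul_left _ ht'
    have h3 := Finset.single_le_sum (f := φ C') (fun _ _ => Nat.zero_le _) (Finset.mem_univ r)
    have h4 := hreach _ _ hr
    omega

end Bounds

section Upper

variable {V : Type} [DecidableEq V] [Fintype V] {G : SimpleGraph V} {A B L LA Z ZA : Finset V}
  {r c h hA : V} {i j : ℕ} {δ δA : V → ℕ}

/-- If the vertices outside `B` are adjacent to `r` or `c`, all of their pairs can be collected on
`r` and `c`, and then all pairs that arrived on `c` can be moved on to `r`. -/
theorem Split.exists_reach (H : Split G r c A B) {X Y : Finset V} (hXB : Disjoint X B)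
    (hYB : Disjoint Y B) (hXY : Disjoint X Y) (hX : ∀ z ∈ X, G.Adj z r) (hY : ∀ z ∈ Y, G.Adj z c)
    (C : V → ℕ) :
    ∃ C', Reach G C C' ∧ ∀ w ∈ B,
      C w + (if w = r then ∑ z ∈ X, C z / 2 + (∑ z ∈ Y, C z / 2) / 2 else 0) +
        (if w = c then (∑ z ∈ Y, C z / 2) % 2 else 0) ≤ C' w := by
  obtain ⟨C₁, hr₁, hC₁, ho₁⟩ := exists_reach_collect X hX C
  obtain ⟨C₂, hr₂, hC₂, ho₂⟩ := exists_reach_collect Y hY C₁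
  have hrX : r ∉ X := Finset.disjoint_right.1 hXB H.root_mem.2
  have hrY : r ∉ Y := Finset.disjoint_right.1 hYB H.root_mem.2
  have hcX : c ∉ X := Finset.disjoint_right.1 hXB H.snd_mem.2
  have hsY : ∑ z ∈ Y, C₁ z / 2 = ∑ z ∈ Y, C z / 2 :=
    Finset.sum_congr rfl fun z hz => by
      rw [ho₁ z (Finset.disjoint_right.1 hXY hz) fun h => hrY (h ▸ hz)]
  rw [hsY, ho₁ c hcX H.adj.ne'] at hC₂
  have hr := ho₂ r hrY H.adj.ne
  have hB : ∀ w ∈ B, w ≠ r → w ≠ c → C₂ w = C w := fun w hw hwr hwc => by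
    rw [ho₂ w (Finset.disjoint_right.1 hYB hw) hwc, ho₁ w (Finset.disjoint_right.1 hXB hw) hwr]
  generalize ∑ z ∈ X, C z / 2 = s₁ at *
  generalize ∑ z ∈ Y, C z / 2 = s₂ at *
  have hmove := reach_single H.adj.symm (C₂ - Pi.single c (2 * (s₂ / 2))) (s₂ / 2)
  have hE : C₂ - Pi.single c (2 * (s₂ / 2)) + Pi.single c (2 * (s₂ / 2)) = C₂ := by
    funext w
    by_cases hw : w = c
    · subst hw; simp; omega
    · simp [hw]
  rw [hE] at hmove
  refine ⟨_, (hr₁.trans hr₂).trans hmove, fun w hw => ?_⟩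
  by_cases hwr : w = r
  · subst hwr
    simp [H.adj.ne]
    omega
  · by_cases hwc : w = c
    · subst hwc
      simp [H.adj.ne']
      omega
    · simp [hwr, hwc, hB w hw hwr hwc]

theorem Layering.sol_of_reach (HL : Layering G B r c i L h δ Z) (H : Split G r c A B)
    {X Y : Finset V} (hXB : Disjoint X B)
    (hYB : Disjoint Y B) (hXY : Disjoint X Y) (hX : ∀ z ∈ X, G.Adj z r) (hY : ∀ z ∈ Y, G.Adj z c)
    {C E : V → ℕ} {k s t : ℕ} (hE : ∀ w ∈ B, E w + (if w = r then k else 0) ≤ C w)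
    (hs : s ≤ t + (k + ∑ z ∈ X, C z / 2 + (∑ z ∈ Y, C z / 2) / 2))
    (ht : t ≠ 0 → t * 2 ^ i + B.card ≤ ∑ w ∈ B, E w + (∑ z ∈ Y, C z / 2) % 2 + 2 * i) :
    Sol G r s C := by
  obtain ⟨C', hr, hC'⟩ := H.exists_reach hXB hYB hXY hX hY C
  generalize ∑ z ∈ X, C z / 2 = s₁ at *
  generalize ∑ z ∈ Y, C z / 2 = s₂ at *
  refine .of_reach hr ?_
  have h1 : Sol G r t fun w => if w ∈ B then E w + if w = c then s₂ % 2 else 0 else 0 := by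
    rcases eq_or_ne t 0 with rfl | ht0
    · exact .of_le (Nat.zero_le _)
    refine HL.sol ?_
    rw [Finset.sum_congr rfl fun w hw => if_pos hw, Finset.sum_add_distrib,
      Finset.sum_ite_eq' _ c, if_pos H.snd_mem.2]
    exact ht ht0
  have h2 : Sol G r (k + s₁ + s₂ / 2) (Pi.single r (k + s₁ + s₂ / 2)) := .of_le (by simp)
  refine (h1.add h2).mono hs fun w => ?_
  by_cases hw : w ∈ B
  · have h3 := hC' w hw
    have h4 := hE w hw
    rw [Pi.add_apply, Pi.single_apply, if_pos hw]
    split_ifs at h3 h4 ⊢ <;> omega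
  · have : w ≠ r := fun h => hw (h ▸ H.root_mem.2)
    simp [hw, this]

theorem Split.sol_of_adj (H : Split G r c A B) (HB : Layering G B r c i L h δ Z)
    (HA : Layering G A r c j LA hA δA ZA) (hji : j ≤ i)
    (hconn : ∀ z ∈ A \ {r, c}, Conn G {r} (A \ {r, c}) z)
    (hadj : ∀ z ∈ A \ {r, c}, G.Adj z r ∨ G.Adj z c) {t : ℕ} (ht : 1 ≤ t) {C : V → ℕ}
    (hC : t * 2 ^ i + Fintype.card V ≤ ∑ v, C v + 2 * i) : Sol G r t C := by
  classical
  rw [H.card_eq, H.sum_eq, sum_eq_two_mul_add_mod] at hC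
  set A' := A \ {r, c} with hA'
  have ho := sum_mod_two_le_card A' C
  have hdA : Disjoint A' B := Finset.disjoint_left.2 fun v hv => H.mem_sdiff.1 hv
  have hXY := Finset.disjoint_filter_filter_not A' A' fun z => G.Adj z r
  have hXA := Finset.filter_subset (fun z => G.Adj z r) A'
  have hYA := Finset.filter_subset (fun z => ¬ G.Adj z r) A'
  have hsplit := fun C : V → ℕ =>
    Finset.sum_filter_add_sum_filter_not A' (fun z => G.Adj z r) fun z => C z / 2
  have hX : ∀ z ∈ A'.filter fun z => G.Adj z r, G.Adj z r := fun z hz =>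
    (Finset.mem_filter.1 hz).2
  have hY : ∀ z ∈ A'.filter fun z => ¬ G.Adj z r, G.Adj z c := fun z hz =>
    (hadj z (hYA hz)).resolve_left (Finset.mem_filter.1 hz).2
  have hY1 : i = 1 → A'.filter (fun z => ¬ G.Adj z r) = ∅ := by
    rintro rfl
    refine Finset.filter_eq_empty_iff.2 fun z hz => not_not.2 ?_
    rw [hA', Finset.mem_sdiff] at hz
    exact HA.adj_root hji z hz.1 fun h => hz.2 (by simp [h])
  generalize A'.filter (fun z => G.Adj z r) = X at *
  generalize A'.filter (fun z => ¬ G.Adj z r) = Y at *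
  have key := fun {C E : V → ℕ} {k s t : ℕ} => HB.sol_of_reach H (hdA.mono_left hXA)
    (hdA.mono_left hYA) hXY hX hY (C := C) (E := E) (k := k) (s := s) (t := t)
  have hi := HB.pos
  rw [← hsplit] at hC
  have hmul : ∀ m k, t = m + k → (i = 1 → t * 2 ^ i = m * 2 ^ i + 2 * k) ∧
      (i ≠ 1 → m * 2 ^ i + 4 * k ≤ t * 2 ^ i) := by
    rintro m k rfl
    refine ⟨?_, fun hi1 => ?_⟩
    · rintro rfl
      ring
    · have : 2 ^ 2 ≤ 2 ^ i := Nat.pow_le_pow_right (by norm_num) (by omega)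
      have := Nat.mul_le_mul_left k this
      rw [add_mul]
      omega
  have hY0 : i = 1 → ∑ z ∈ Y, C z / 2 = 0 := fun h => by simp [hY1 h]
  by_cases hbad : ∑ z ∈ X, C z / 2 = 0 ∧ (∑ z ∈ Y, C z / 2) % 2 = 1 ∧
      A'.card ≤ ∑ z ∈ A', C z % 2
  · obtain ⟨hX0, hY2, hodd⟩ := hbad
    obtain ⟨z, hz, hz2⟩ := exists_pair (L := Y) (C := C) (by omega)
    obtain ⟨y, hy, C', hr, hB, hs⟩ := (hconn z (hYA hz)).exists_reach
      (Finset.disjoint_singleton_left.2 fun h => Finset.disjoint_left.1 hdA h H.root_mem.2)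
      (fun w hw _ => odd_of_card_le_sum_mod_two hodd w hw) hz2
    obtain rfl := Finset.mem_singleton.1 hy
    rw [← hsplit, ← hsplit] at hs
    refine .of_reach hr (key (E := C) (k := 1) (t := t - (1 + (∑ z ∈ Y, C z / 2) / 2))
      (fun w hw => (hB w (Finset.disjoint_right.1 hdA hw)).ge) (by omega) fun h0 => ?_)
    obtain ⟨h1, h2⟩ := hmul (t - (1 + (∑ z ∈ Y, C z / 2) / 2))
      (1 + (∑ z ∈ Y, C z / 2) / 2) (by omega)
    omega
  · refine key (E := C) (k := 0)
      (t := t - (∑ z ∈ X, C z / 2 + (∑ z ∈ Y, C z / 2) / 2)) (by simp) (by omega) fun h0 => ?_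
    obtain ⟨h1, h2⟩ := hmul (t - (∑ z ∈ X, C z / 2 + (∑ z ∈ Y, C z / 2) / 2))
      (∑ z ∈ X, C z / 2 + (∑ z ∈ Y, C z / 2) / 2) (by omega)
    omega

theorem Split.sol_of_lt (H : Split G r c A B) (HB : Layering G B r c i L h δ Z)
    (HA : Layering G A r c j LA hA δA ZA) (hji : j ≤ i) (hj : 2 ≤ j) {t : ℕ} (ht : 1 ≤ t)
    {C : V → ℕ} (hC : t * 2 ^ (i + 1) + Fintype.card V ≤ ∑ v, C v + 2 * (i + 1)) :
    Sol G r t C := by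
  rw [H.card_eq, H.sum_eq] at hC
  have hcA := H.card_left
  set A' := A \ {r, c}
  let CA : V → ℕ := fun w => if w ∈ B then 0 else C w
  let CB : V → ℕ := fun w => if w ∈ B then C w else 0
  have hsA : ∑ w ∈ A', C w ≤ ∑ w ∈ A, CA w := by
    rw [Finset.sum_congr rfl fun w hw => (if_neg (H.mem_sdiff.1 hw)).symm]
    exact Finset.sum_le_sum_of_subset Finset.sdiff_subset
  have hsB : ∑ w ∈ B, CB w = ∑ w ∈ B, C w := Finset.sum_congr rfl fun w hw => if_pos hw
  set sA := ∑ w ∈ A', C w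
  set sB := ∑ w ∈ B, C w
  have hsol : ∀ {B L h i δ Z} (HL : Layering G B r c i L h δ Z) (C : V → ℕ),
      Sol G r ((∑ w ∈ B, C w + 2 * i - B.card) / 2 ^ i) C := by
    intro B L h i δ Z HL C
    rcases Nat.eq_zero_or_pos ((∑ w ∈ B, C w + 2 * i - B.card) / 2 ^ i) with h0 | h0
    · rw [h0]
      exact .of_le (Nat.zero_le _)
    · refine HL.sol ?_
      have h1 := Nat.div_mul_le_self (∑ w ∈ B, C w + 2 * i - B.card) (2 ^ i)
      have h2 := Nat.mul_pos h0 (show 0 < 2 ^ i by positivity)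
      omega
  have hlt : ∀ x k : ℕ, x < (x / 2 ^ k + 1) * 2 ^ k := fun x k =>
    mul_comm (2 ^ k) (x / 2 ^ k + 1) ▸ Nat.lt_mul_div_succ x (by positivity)
  refine ((hsol HA CA).add (hsol HB CB)).mono ?_ fun w => ?_
  · have h1 := hlt (∑ w ∈ A, CA w + 2 * j - A.card) j
    have h2 := hlt (∑ w ∈ B, CB w + 2 * i - B.card) i
    generalize (∑ w ∈ A, CA w + 2 * j - A.card) / 2 ^ j = p at *
    generalize (∑ w ∈ B, CB w + 2 * i - B.card) / 2 ^ i = q at *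
    by_contra! hpq
    have h3 : (p + 1) * 2 ^ j ≤ (p + 1) * 2 ^ i :=
      Nat.mul_le_mul_left _ (Nat.pow_le_pow_right (by norm_num) hji)
    have h4 : (p + 1) * 2 ^ i + (q + 1) * 2 ^ i ≤ (t + 1) * 2 ^ i := by
      rw [← add_mul]
      exact Nat.mul_le_mul_right _ (by omega)
    have h5 : (t + 1) * 2 ^ i ≤ t * 2 ^ (i + 1) := by
      rw [pow_succ', ← mul_assoc]
      exact Nat.mul_le_mul_right _ (by omega)
    omega
  · simp only [CA, CB, Pi.add_apply]
    split_ifs <;> simp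

theorem Split.sol (H : Split G r c A B) (hG : G.Connected) (HB : Layering G B r c i L h δ Z)
    (HA : Layering G A r c j LA hA δA ZA) (hji : j ≤ i)
    (hconn : ∀ z ∈ A \ {r, c}, Conn G {r} (A \ {r, c}) z) {t : ℕ} (ht : 1 ≤ t) {C : V → ℕ}
    (hC : t * 2 ^ G.diam + Fintype.card V ≤ ∑ v, C v + 2 * G.diam) : Sol G r t C := by
  by_cases hadj : ∀ z ∈ A \ {r, c}, G.Adj z r ∨ G.Adj z c
  · have := mul_two_pow_add_le ht HB.pos (HB.le_diam H hG)
    exact H.sol_of_adj HB HA hji hconn hadj ht (by omega)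
  · push Not at hadj
    obtain ⟨u, hu, hur, huc⟩ := hadj
    have := mul_two_pow_add_le ht (Nat.le_add_left 1 i) (HB.lt_diam H hG (H.mem_sdiff.1 hu) hur huc)
    refine H.sol_of_lt HB HA hji ?_ ht (by omega)
    by_contra! hj
    rw [Finset.mem_sdiff] at hu
    exact hur (HA.adj_root (by omega) u hu.1 fun h => hu.2 (by simp [h]))

theorem Strip.exists_split {a b p q : V} (H : Strip G Finset.univ a b p q) (r : V) :
    ∃ c p q p' q' A B, Strip G A r c p q ∧ Strip G B r c p' q' ∧ Split G r c A B := by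
  obtain ⟨c, p', q', A, B, HA, HB, hU, hI, hE⟩ := H.split (Finset.mem_univ r)
  exact ⟨c, p', q', p, q, A, B, HA, HB, hU, hI, HB.back_adj, hE⟩

theorem Strip.sol {a b p q : V} (H : Strip G Finset.univ a b p q) (r : V) {t : ℕ} (ht : 1 ≤ t)
    {C : V → ℕ} (hC : t * 2 ^ G.diam + Fintype.card V ≤ ∑ v, C v + 2 * G.diam) : Sol G r t C := by
  obtain ⟨c, _, _, _, _, A, B, SA, SB, HS⟩ := H.exists_split r
  obtain ⟨j, _, _, _, _, HA, -⟩ := SA.exists_layering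
  obtain ⟨i, _, _, _, _, HB, -⟩ := SB.exists_layering
  rcases le_total j i with hji | hij
  · exact HS.sol H.connected HB HA hji SA.conn ht hC
  · exact HS.symm.sol H.connected HA HB hij SB.conn ht hC

theorem Strip.exists_not_sol {a b p q : V} (H : Strip G Finset.univ a b p q) {t : ℕ}
    (ht : 1 ≤ t) : ∃ (r : V) (C : V → ℕ),
      t * 2 ^ G.diam + Fintype.card V ≤ ∑ v, C v + 2 * G.diam + 1 ∧ ¬ Sol G r t C := by
  have hG := H.connected
  have := hG.nonempty
  obtain ⟨r, y, hry⟩ := G.exists_dist_eq_diam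
  have key : ∀ {A B c p q}, Strip G B r c p q → Split G r c A B → y ∈ B →
      ∃ C : V → ℕ, t * 2 ^ G.diam + Fintype.card V ≤ ∑ v, C v + 2 * G.diam + 1 ∧
        ¬ Sol G r t C := by
    intro A B c p q SB HS hy
    obtain ⟨i, _, _, _, _, HB, -⟩ := SB.exists_layering
    have hi : i = G.diam := le_antisymm (HB.le_diam HS hG) (hry ▸ HB.dist_le hG y hy)
    exact hi ▸ HB.exists_not_sol HS ht
  obtain ⟨c, _, _, _, _, A, B, SA, SB, HS⟩ := H.exists_split r
  refine ⟨r, ?_⟩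
  by_cases hy : y ∈ B
  · exact key SB HS hy
  · exact key SA HS.symm (HS.mem_left hy)

end Upper

theorem exists_le_sum_eq {V : Type} [Fintype V] (C : V → ℕ) {m : ℕ} (hm : m ≤ ∑ v, C v) :
    ∃ C' : V → ℕ, (∀ v, C' v ≤ C v) ∧ ∑ v, C' v = m := by
  classical
  obtain ⟨k, hk⟩ := Nat.exists_eq_add_of_le hm
  induction k generalizing C with
  | zero => exact ⟨C, fun _ => le_rfl, hk⟩
  | succ k ih =>
    obtain ⟨v, hv, h0⟩ :=
      Finset.exists_ne_zero_of_sum_ne_zero (s := Finset.univ) (f := C) (by omega)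
    have h1 := Finset.add_sum_erase _ C hv
    have h2 := Finset.add_sum_erase _ (Function.update C v (C v - 1)) hv
    rw [Finset.sum_congr rfl fun x hx =>
      Function.update_of_ne (Finset.ne_of_mem_erase hx) _ _, Function.update_self] at h2
    obtain ⟨C', hC', hs⟩ := ih (Function.update C v (C v - 1)) (by omega) (by omega)
    refine ⟨C', fun x => (hC' x).trans ?_, hs⟩
    by_cases hx : x = v
    · subst hx; simp
    · simp [hx]

end TwoPath

theorem twopath_tfold_pebbling {V : Type} [Fintype V] [DecidableEq V]
    (G : SimpleGraph V) (hG : IsTwoPath G) (d n t : ℕ)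
    (hd : G.diam = d) (hn : Fintype.card V = n) (ht : 1 ≤ t) :
    tPebblingNumber G t = t * 2 ^ d + n - 2 * d := by
  subst hd hn
  obtain ⟨a, b, p, q, H⟩ := TwoPath.exists_strip hG
  have hmem : ∀ r, t * 2 ^ G.diam + Fintype.card V - 2 * G.diam ∈
      {m | ∀ C : V → ℕ, ∑ v, C v = m → Solvable G C (stack r t)} := fun r C hC =>
    TwoPath.sol_iff.2 (H.sol r ht (by omega))
  refine le_antisymm (Finset.sup_le fun r _ => Nat.sInf_le (hmem r)) ?_
  obtain ⟨r, C, hC, hns⟩ := H.exists_not_sol ht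
  refine le_trans ?_ (Finset.le_sup (Finset.mem_univ r))
  by_contra! hlt
  have hinf := Nat.sInf_mem ⟨_, hmem r⟩
  obtain ⟨C', hle, hsum⟩ :=
    TwoPath.exists_le_sum_eq C (m := pebblingNumber G (stack r t)) (by omega)
  exact hns ((TwoPath.sol_iff.1 (hinf C' hsum)).mono le_rfl hle)
end

section
/- Let G be a 2-path with diameter d on n vertices and let r be any vertex. Then every configuration C on G of size at least 2^{d+1} + n − 2d (which equals π_2(G)) has an r-solution of cost at most 2^{ecc(r)}; in particular, of cost at most 2^d. -/
/-- From `C`, at least `m` pebbles can be brought to `v` at an average cost of at most `2 ^ k`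
each. -/
def CanBring {V : Type} [DecidableEq V] (G : SimpleGraph V) (k : ℕ) (v : V) (m : ℕ)
    (C : V → ℕ) : Prop :=
  ∃ (j : ℕ) (C' : V → ℕ), StepsN G j C C' ∧ m ≤ C' v ∧ j + m ≤ m * 2 ^ k

section Pebbling

variable {V : Type} [DecidableEq V] {G : SimpleGraph V}

theorem PebblingStep.add_right {C C' : V → ℕ} (h : PebblingStep G C C') (E : V → ℕ) :
    PebblingStep G (C + E) (C' + E) := by
  obtain ⟨u, v, huv, hu, rfl⟩ := h
  refine ⟨u, v, huv, by simp only [Pi.add_apply]; omega, ?_⟩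
  funext w
  simp only [Pi.add_apply]
  split_ifs with h1 h2
  · subst h1; omega
  · subst h2; omega
  · rfl

theorem StepsN.add_right {j : ℕ} {C C' : V → ℕ} (h : StepsN G j C C') (E : V → ℕ) :
    StepsN G j (C + E) (C' + E) := by
  induction h with
  | refl C => exact .refl _
  | tail _ hs ih => exact ih.tail (hs.add_right E)

theorem StepsN.trans {i j : ℕ} {C C' C'' : V → ℕ} (h : StepsN G i C C')
    (h' : StepsN G j C' C'') : StepsN G (i + j) C C'' := by
  induction h' with
  | refl C => exact h
  | tail _ hs ih => exact (ih h).tail hs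

theorem StepsN.exists_move {u v : V} (huv : G.Adj u v) (m : ℕ) {C : V → ℕ} (hC : 2 * m ≤ C u) :
    ∃ C', StepsN G m C C' ∧ m ≤ C' v := by
  suffices ∃ C', StepsN G m C C' ∧ m ≤ C' v ∧ C u ≤ C' u + 2 * m by
    obtain ⟨C', h, h', -⟩ := this
    exact ⟨C', h, h'⟩
  induction m with
  | zero => exact ⟨C, .refl C, by omega, by omega⟩
  | succ m ih =>
    obtain ⟨C', hs, hv, hu⟩ := ih (by omega)
    refine ⟨_, hs.tail ⟨u, v, huv, by omega, rfl⟩, ?_, ?_⟩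
    · simp only [huv.ne', if_true, if_false]; omega
    · simp only [if_true]; omega

theorem CanBring.mono_config {k m : ℕ} {v : V} {C D : V → ℕ} (h : CanBring G k v m C)
    (hCD : C ≤ D) : CanBring G k v m D := by
  obtain ⟨j, C', hs, hv, hj⟩ := h
  refine ⟨j, C' + (D - C), ?_, ?_, hj⟩
  · simpa only [add_tsub_cancel_of_le hCD] using hs.add_right (D - C)
  · simp only [Pi.add_apply]; omega

theorem CanBring.mono_depth {k l m : ℕ} {v : V} {C : V → ℕ} (h : CanBring G k v m C)
    (hkl : k ≤ l) : CanBring G l v m C := by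
  obtain ⟨j, C', hs, hv, hj⟩ := h
  exact ⟨j, C', hs, hv, hj.trans (Nat.mul_le_mul_left _ (Nat.pow_le_pow_right two_pos hkl))⟩

theorem CanBring.of_le {m : ℕ} {v : V} {C : V → ℕ} (k : ℕ) (h : m ≤ C v) :
    CanBring G k v m C :=
  ⟨0, C, .refl C, h, by simpa using Nat.le_mul_of_pos_right m (by positivity)⟩

theorem CanBring.add {k m m' : ℕ} {v : V} {C D : V → ℕ} (h : CanBring G k v m C)
    (h' : CanBring G k v m' D) : CanBring G k v (m + m') (C + D) := by
  obtain ⟨i, C', hC, hv, hi⟩ := h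
  obtain ⟨j, D', hD, hv', hj⟩ := h'
  refine ⟨i + j, C' + D', (hC.add_right D).trans ?_, ?_, ?_⟩
  · simpa only [add_comm C'] using hD.add_right C'
  · simp only [Pi.add_apply]; omega
  · rw [add_mul]; omega

theorem CanBring.move {k m : ℕ} {u v : V} {C : V → ℕ} (huv : G.Adj u v)
    (h : CanBring G k u (2 * m) C) : CanBring G (k + 1) v m C := by
  obtain ⟨j, C', hs, hu, hj⟩ := h
  obtain ⟨C'', hs', hv⟩ := StepsN.exists_move huv m hu
  refine ⟨j + m, C'', hs.trans hs', hv, ?_⟩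
  have : m * 2 ^ (k + 1) = 2 * m * 2 ^ k := by ring
  omega

theorem CanBring.cheaplySolvable {k : ℕ} {r : V} {C : V → ℕ} (h : CanBring G k r 1 C) :
    CheaplySolvable G C r (2 ^ k) := by
  obtain ⟨j, C', hs, hv, hj⟩ := h
  exact ⟨j, C', hs, hv, by simpa using hj⟩

theorem CanBring.sum {ι : Type*} {k : ℕ} {v : V} (L : Finset ι) {c : ι → ℕ} {F : ι → V → ℕ}
    (h : ∀ i ∈ L, ∀ m ≤ c i, CanBring G k v m (F i)) {m : ℕ} (hm : m ≤ ∑ i ∈ L, c i) :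
    CanBring G k v m (∑ i ∈ L, F i) := by
  classical
  induction L using Finset.induction_on generalizing m with
  | empty => exact .of_le k (by simpa using hm)
  | insert i L hi ih =>
    rw [Finset.sum_insert hi] at hm ⊢
    have hm' : m = min m (c i) + (m - min m (c i)) := by omega
    rw [hm']
    exact (h i (Finset.mem_insert_self i L) _ (min_le_right _ _)).add
      (ih (fun j hj => h j (Finset.mem_insert_of_mem hj)) (by omega))

/-- Pebbles are brought along a walk whose vertices have their own local supplies. -/
theorem CanBring.walk {x s : V} (p : G.Walk x s) {F : V → V → ℕ} {c g : V → ℕ}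
    (h : ∀ z, ∀ m ≤ c z, CanBring G 1 z m (F z)) (hs : ∀ m ≤ c s, CanBring G 0 s m (F s))
    (hg : ∀ z, g z ≤ 2 * c z) (hgs : g s ≤ c s) {m : ℕ}
    (hm : m * 2 ^ p.length ≤ (p.support.map g).sum) :
    CanBring G p.length x m (p.support.map F).sum := by
  induction p generalizing m with
  | nil =>
    simp only [SimpleGraph.Walk.length_nil, SimpleGraph.Walk.support_nil, List.map_cons,
      List.map_nil, List.sum_cons, List.sum_nil, pow_zero, mul_one, add_zero] at hm ⊢
    exact hs m (hm.trans hgs)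
  | @cons x y s hxy p ih =>
    simp only [SimpleGraph.Walk.length_cons, SimpleGraph.Walk.support_cons, List.map_cons,
      List.sum_cons] at hm ⊢
    have hm' : m = min m (c x) + (m - min m (c x)) := by omega
    rw [hm']
    refine ((h x _ (min_le_right _ _)).mono_depth (by omega)).add (.move hxy.symm (ih hs hgs ?_))
    rcases le_total m (c x) with hle | hle
    · simp [min_eq_left hle]
    · obtain ⟨t, rfl⟩ := Nat.exists_eq_add_of_le hle
      have h1 := hg x
      have h2 : c x ≤ c x * 2 ^ p.length := Nat.le_mul_of_pos_right _ (by positivity)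
      rw [min_eq_right hle, Nat.add_sub_cancel_left]
      have h3 : (c x + t) * 2 ^ (p.length + 1) =
        2 * (c x * 2 ^ p.length) + 2 * t * 2 ^ p.length := by ring
      omega

/-- Pebbles are brought along a path to which the vertices of `L` are attached as leaves. -/
theorem CanBring.caterpillar {r s : V} {p : G.Walk r s} (hp : p.IsPath) {L : Finset V}
    {par : V → V} (hL : ∀ l ∈ L, l ∉ p.support) (hadj : ∀ l ∈ L, G.Adj l (par l))
    (hpar : ∀ l ∈ L, par l ∈ p.support) (hs : ∀ l ∈ L, par l ≠ s) {C : V → ℕ}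
    (hC : 2 ^ p.length ≤ ∑ z ∈ p.support.toFinset, C z + ∑ l ∈ L, (C l - 1)) :
    CanBring G p.length r 1 C := by
  have hmaps : ∀ l ∈ L, par l ∈ p.support.toFinset := fun l hl => by simpa using hpar l hl
  have hempty : L.filter (fun l => par l = s) = ∅ :=
    Finset.filter_eq_empty_iff.2 fun l hl => hs l hl
  have hstack : ∀ (k : ℕ) (z : V), ∀ m ≤ C z, CanBring G k z m (stack z (C z)) :=
    fun k z m hm => .of_le k (by simpa [stack] using hm)
  have key := CanBring.walk (m := 1) p
    (F := fun z => stack z (C z) + ∑ l ∈ L with par l = z, stack l (C l))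
    (c := fun z => C z + ∑ l ∈ L with par l = z, C l / 2)
    (g := fun z => C z + ∑ l ∈ L with par l = z, (C l - 1)) ?_ ?_ ?_ ?_ ?_
  · refine key.mono_config ?_
    rw [← List.sum_toFinset _ hp.support_nodup, Finset.sum_add_distrib,
      Finset.sum_fiberwise_of_maps_to hmaps, ← Finset.sum_union]
    · intro w
      simp only [Finset.sum_apply, stack]
      rw [Finset.sum_ite_eq]
      split_ifs <;> simp
    · exact Finset.disjoint_right.2 fun l hl => by simpa using hL l hl
  · intro z m hm
    have hm' : m = min m (C z) + (m - min m (C z)) := by omega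
    rw [hm']
    refine (hstack 1 z _ (min_le_right _ _)).add
      (CanBring.sum (c := fun l => C l / 2) _ (fun l hl m hm => ?_) (by omega))
    obtain ⟨hlL, rfl⟩ := Finset.mem_filter.1 hl
    exact .move (hadj l hlL) (hstack 0 l _ (by omega))
  · simpa [hempty] using hstack 0 s
  · intro z
    rw [mul_add, Finset.mul_sum]
    exact add_le_add (by omega) (Finset.sum_le_sum fun l _ => by omega)
  · simp [hempty]
  · rwa [← List.sum_toFinset _ hp.support_nodup, Finset.sum_add_distrib,
      Finset.sum_fiberwise_of_maps_to hmaps, one_mul]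

end Pebbling

section Structure

theorem IsSimplicial.induce {V : Type} {G : SimpleGraph V} {S : Set V} {w : S}
    (h : IsSimplicial G w) : IsSimplicial (G.induce S) w :=
  fun a b ha hb hab => h a b ha hb (Subtype.coe_injective.ne hab)

theorem isSimplicial_of_complete {V : Type} {G : SimpleGraph V}
    (h : ∀ a b : V, a ≠ b → G.Adj a b) (v : V) : IsSimplicial G v :=
  fun a b _ _ hab => h a b hab

theorem IsTwoPath.nontrivial {V : Type} {G : SimpleGraph V} (hG : IsTwoPath G) :
    Nontrivial V := by
  cases hG with
  | complete2 _ h _ =>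
    have : Finite V := Nat.finite_of_card_ne_zero (by omega)
    exact Finite.one_lt_card_iff_nontrivial.1 (by omega)
  | complete3 _ h _ =>
    have : Finite V := Nat.finite_of_card_ne_zero (by omega)
    exact Finite.one_lt_card_iff_nontrivial.1 (by omega)
  | extend _ u v huv => exact ⟨u, v, huv⟩

theorem IsTwoPath.connected {V : Type} {G : SimpleGraph V} (hG : IsTwoPath G) :
    G.Connected := by
  induction hG with
  | complete2 G h hc | complete3 G h hc =>
    have := (IsTwoPath.nontrivial (by first | exact .complete2 G h hc | exact .complete3 G h hc))
    refine (SimpleGraph.connected_iff _).2 ⟨fun a b => ?_, inferInstance⟩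
    by_cases hab : a = b
    · exact hab ▸ .refl a
    · exact (hc a b hab).reachable
  | @extend V G u v huv _ hcard _ _ ih =>
    have hne : (G.neighborSet v).Nonempty :=
      Set.nonempty_of_ncard_ne_zero (by omega)
    obtain ⟨x, hx⟩ := hne
    have hxv : G.Adj v x := hx
    have hto : ∀ a, G.Reachable a x := fun a => by
      by_cases ha : a = v
      · exact ha ▸ hxv.reachable
      · exact (ih.preconnected ⟨a, ha⟩ ⟨x, hxv.ne'⟩).map (SimpleGraph.Embedding.induce _).toHom
    exact (SimpleGraph.connected_iff _).2 ⟨fun a b => (hto a).trans (hto b).symm, ⟨v⟩⟩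

theorem IsTwoPath.exists_isSimplicial {V : Type} {G : SimpleGraph V} (hG : IsTwoPath G) :
    ∃ s t : V, s ≠ t ∧ IsSimplicial G s ∧ IsSimplicial G t := by
  have := hG.nontrivial
  cases hG with
  | complete2 _ _ hc | complete3 _ _ hc =>
    obtain ⟨s, t, hst⟩ := exists_pair_ne V
    exact ⟨s, t, hst, isSimplicial_of_complete hc s, isSimplicial_of_complete hc t⟩
  | extend _ u v huv hset =>
    exact ⟨u, v, huv, hset.ge (by simp), hset.ge (by simp)⟩

/-- In a 2-path, a walk between distinct simplicial vertices is dominating. -/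
theorem IsTwoPath.exists_mem_support {V : Type} {G : SimpleGraph V} (hG : IsTwoPath G)
    {s t : V} (hst : s ≠ t) (hs : IsSimplicial G s) (ht : IsSimplicial G t) (p : G.Walk s t)
    (w : V) : ∃ z ∈ p.support, z = w ∨ G.Adj w z := by
  classical
  induction hG with
  | complete2 G _ hc | complete3 G _ hc =>
    refine ⟨s, p.start_mem_support, ?_⟩
    by_cases h : s = w
    · exact .inl h
    · exact .inr (hc _ _ (Ne.symm h))
  | @extend V G u v huv hset _ hv hG' ih =>
    have hu : IsSimplicial G u := hset.ge (by simp)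
    suffices H : ∀ q : G.Walk v u, ∃ z ∈ q.support, z = w ∨ G.Adj w z by
      have hs' : s = u ∨ s = v := by simpa using hset.le hs
      have ht' : t = u ∨ t = v := by simpa using hset.le ht
      rcases hs' with rfl | rfl <;> rcases ht' with rfl | rfl
      · exact absurd rfl hst
      · simpa using H p.reverse
      · exact H p
      · exact absurd rfl hst
    intro q
    by_cases hwv : w = v
    · exact ⟨v, q.start_mem_support, .inl hwv.symm⟩
    obtain ⟨a, ha, has⟩ : ∃ a : {w : V | w ≠ v}, a ≠ ⟨u, huv⟩ ∧
        IsSimplicial (G.induce {w : V | w ≠ v}) a := by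
      obtain ⟨a, b, hab, ha, hb⟩ := hG'.exists_isSimplicial
      by_cases h : a = ⟨u, huv⟩
      · exact ⟨b, fun h' => hab (h.trans h'.symm), hb⟩
      · exact ⟨a, h, ha⟩
    have hva : G.Adj v a := by
      by_contra hva
      have hsimp : IsSimplicial G a := fun b c hb hc hbc =>
        has ⟨b, fun h => hva (h ▸ hb.symm)⟩ ⟨c, fun h => hva (h ▸ hc.symm)⟩ hb hc
          (by simpa [Subtype.ext_iff] using hbc)
      rcases hset.le hsimp with h | h
      · exact ha (Subtype.ext h)
      · exact a.2 h
    suffices H : ∀ q : G.Walk v u, q.IsPath → ∃ z ∈ q.support, z = w ∨ G.Adj w z by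
      obtain ⟨z, hz, h⟩ := H q.bypass q.bypass_isPath
      exact ⟨z, q.support_bypass_subset_support hz, h⟩
    clear q
    intro q hq
    cases q with
    | nil => exact absurd rfl huv
    | @cons _ y _ hvy q =>
      have hvq : ∀ z ∈ q.support, z ∈ {w : V | w ≠ v} := fun z hz h =>
        ((SimpleGraph.Walk.cons_isPath_iff _ _).1 hq).2 (h ▸ hz)
      have hq' := q.support_induce hvq
      have hmem : ∀ z, z ∈ (q.induce _ hvq).support → (z : V) ∈ q.support := fun z hz => by
        rw [hq'] at hz
        simpa using hz
      by_cases hay : (a : V) = y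
      · obtain ⟨z, hz, h⟩ := ih ha has hu.induce
          ((q.induce _ hvq).copy (Subtype.ext hay.symm) rfl) ⟨w, hwv⟩
        refine ⟨z, .tail _ (hmem z (by simpa using hz)), ?_⟩
        simpa [Subtype.ext_iff] using h
      · have hady : G.Adj a y := hv a y hva hvy hay
        obtain ⟨z, hz, h⟩ := ih ha has hu.induce
          (.cons (show (G.induce _).Adj a ⟨y, _⟩ from hady) (q.induce _ hvq)) ⟨w, hwv⟩
        have hzw : (z : V) = w ∨ G.Adj w z := by simpa [Subtype.ext_iff] using h
        rcases (by simpa using hz : z = a ∨ z ∈ (q.induce _ hvq).support) with rfl | hz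
        · refine ⟨y, .tail _ q.start_mem_support, ?_⟩
          rcases hzw with rfl | hzw
          · exact .inr hady
          · by_cases hyw : y = w
            · exact .inl hyw
            · exact .inr (has ⟨w, hwv⟩ ⟨y, hvy.ne'⟩ hzw.symm hady
                (fun h => hyw (congrArg Subtype.val h).symm))
        · exact ⟨z, .tail _ (hmem z hz), hzw⟩

/-- A vertex dominated by a walk ending in a simplicial vertex is dominated by one of the other
vertices of the walk. -/
theorem SimpleGraph.Walk.exists_adj_ne_of_isSimplicial {V : Type} {G : SimpleGraph V} {r s : V}
    (p : G.Walk r s) (hrs : r ≠ s) (hs : IsSimplicial G s) {w z : V} (hw : w ∉ p.support)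
    (hz : z ∈ p.support) (hwz : G.Adj w z) : ∃ y ∈ p.support, y ≠ s ∧ G.Adj w y := by
  by_cases hzs : z = s
  · subst hzs
    have hnil : ¬ p.Nil := SimpleGraph.Walk.not_nil_of_ne hrs
    have hpen := p.adj_penultimate hnil
    have hmem := List.mem_of_mem_dropLast (p.penultimate_mem_dropLast_support hnil)
    exact ⟨p.penultimate, hmem, hpen.ne,
      hs _ _ hwz.symm hpen.symm fun h => hw (h ▸ hmem)⟩
  · exact ⟨z, hz, hzs, hwz⟩

end Structure

theorem two_pow_add_two_pow_lt {a b d c : ℕ} (ha : a ≤ d) (hb : b ≤ d)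
    (hab : a + b ≤ d + 2) (hac : a + 1 ≤ c) (hbc : b + 1 ≤ c) :
    2 ^ a + 2 ^ b + 2 * d < 2 ^ (d + 1) + c + 2 := by
  rw [pow_succ]
  have hda : 2 ^ a ≤ 2 ^ d := Nat.pow_le_pow_right two_pos ha
  have hdb : 2 ^ b ≤ 2 ^ d := Nat.pow_le_pow_right two_pos hb
  obtain hd | ⟨d, rfl⟩ : d = 0 ∨ ∃ e, d = e + 1 := by cases d <;> simp
  · omega
  have hlt : d < 2 ^ d := Nat.lt_two_pow_self
  have hs : 2 ^ (d + 1) = 2 * 2 ^ d := by ring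
  have hlow : ∀ {x : ℕ}, x ≤ d → 2 ^ x ≤ 2 ^ d := fun hx => Nat.pow_le_pow_right two_pos hx
  by_cases h1 : a ≤ d
  · have := hlow h1
    by_cases h2 : b ≤ d
    · have := hlow h2
      omega
    · omega
  · by_cases h2 : b ≤ d
    · have := hlow h2
      omega
    · omega

theorem IsTwoPath.canBring_eccentricity {V : Type} [Fintype V] [DecidableEq V]
    {G : SimpleGraph V} (hG : IsTwoPath G) (r : V) {C : V → ℕ}
    (hC : 2 ^ (G.diam + 1) + Fintype.card V - 2 * G.diam ≤ ∑ v, C v) :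
    CanBring G (eccentricity G r) r 1 C := by
  classical
  have hconn := hG.connected
  have hdiam : ∀ x y, G.dist x y ≤ G.diam := fun x y =>
    have := hconn.nonempty
    SimpleGraph.dist_le_diam (SimpleGraph.connected_iff_ediam_ne_top.1 hconn)
  have hecc : ∀ x, G.dist r x ≤ eccentricity G r := fun x =>
    Finset.le_sup (f := fun v => G.dist r v) (Finset.mem_univ x)
  obtain ⟨s, t, hst, hs, ht⟩ := hG.exists_isSimplicial
  obtain ⟨p, hp, hpl⟩ := hconn.exists_path_of_dist r s
  obtain ⟨q, hq, hql⟩ := hconn.exists_path_of_dist r t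
  have hsum : G.dist r s + G.dist r t ≤ G.diam + 2 := by
    obtain ⟨o, ho⟩ := hconn.exists_walk_length_eq_dist s t
    obtain ⟨z, hz, hrz⟩ := hG.exists_mem_support hst hs ht o r
    have hrz' : G.dist r z ≤ 1 := by
      rcases hrz with rfl | h
      · simp
      · exact (SimpleGraph.dist_eq_one_iff_adj.2 h).le
    have h1 := SimpleGraph.dist_le (o.takeUntil z hz)
    have h2 := SimpleGraph.dist_le (o.dropUntil z hz)
    have h3 := congrArg SimpleGraph.Walk.length (o.take_spec hz)
    rw [SimpleGraph.Walk.length_append] at h3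
    have h4 := hconn.dist_triangle (u := r) (v := z) (w := s)
    have h5 := hconn.dist_triangle (u := r) (v := z) (w := t)
    have h6 := hdiam s t
    rw [SimpleGraph.dist_comm (u := z) (v := s)] at h4
    omega
  by_contra hcon
  set P := p.support.toFinset with hP
  set Q := q.support.toFinset with hQ
  set A := {w ∈ (P ∪ Q)ᶜ | ∃ y ∈ p.support, y ≠ s ∧ G.Adj w y} with hA
  set B := (P ∪ Q)ᶜ \ A with hB
  have hmemA : ∀ w ∈ A, w ∉ p.support ∧ ∃ y ∈ p.support, y ≠ s ∧ G.Adj w y := fun w hw => by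
    rw [hA, Finset.mem_filter] at hw
    exact ⟨fun h => by simp [hP, h] at hw, hw.2⟩
  have hmemB : ∀ w ∈ B, w ∉ q.support ∧ ∃ y ∈ q.support, y ≠ t ∧ G.Adj w y := fun w hw => by
    obtain ⟨hw, hwA⟩ := Finset.mem_sdiff.1 hw
    have hwp : w ∉ p.support := fun h => by simp [hP, h] at hw
    have hwq : w ∉ q.support := fun h => by simp [hQ, h] at hw
    have hno : ¬ ∃ y ∈ p.support, y ≠ s ∧ G.Adj w y := fun h =>
      hwA (Finset.mem_filter.2 ⟨hw, h⟩)
    refine ⟨hwq, ?_⟩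
    obtain ⟨z, hz, hwz⟩ := hG.exists_mem_support hst hs ht (p.reverse.append q) w
    have hz' : z ∈ p.support ∨ z ∈ q.support := by
      simpa [SimpleGraph.Walk.mem_support_append_iff] using hz
    have hwz : G.Adj w z := by
      rcases hwz with rfl | h
      · exact absurd hz' (by simp [hwp, hwq])
      · exact h
    rcases hz' with hz | hz
    · by_cases hrs : r = s
      · subst hrs
        have hzr : z = r := by
          by_contra h
          exact hno ⟨z, hz, h, hwz⟩
        exact ⟨r, q.start_mem_support, hst, hzr ▸ hwz⟩
      · exact absurd (p.exists_adj_ne_of_isSimplicial hrs hs hwp hz hwz) hno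
    · by_cases hrt : r = t
      · subst hrt
        rw [(SimpleGraph.Walk.isPath_iff_nil.1 hq).eq_nil] at hz
        have hzr : z = r := by simpa using hz
        exact absurd ⟨r, p.start_mem_support, hst.symm, hzr ▸ hwz⟩ hno
      · exact q.exists_adj_ne_of_isSimplicial hrt ht hwq hz hwz
  have bound : ∀ {x : V} {o : G.Walk r x} {L : Finset V}, o.IsPath → o.length = G.dist r x →
      (∀ w ∈ L, w ∉ o.support ∧ ∃ y ∈ o.support, y ≠ x ∧ G.Adj w y) →
      ∑ z ∈ o.support.toFinset, C z + ∑ l ∈ L, (C l - 1) < 2 ^ G.dist r x := by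
    intro x o L ho hol hL
    by_contra! h
    choose! par hpar using fun w hw => (hL w hw).2
    exact hcon ((CanBring.caterpillar ho (fun l hl => (hL l hl).1)
      (fun l hl => (hpar l hl).2.2) (fun l hl => (hpar l hl).1) (fun l hl => (hpar l hl).2.1)
      (hol.symm ▸ h)).mono_depth (hol.trans_le (hecc x)))
  have hbP : ∑ z ∈ P, C z + _ < _ := bound hp hpl hmemA
  have hbQ : ∑ z ∈ Q, C z + _ < _ := bound hq hql hmemB
  have hsub : ∀ L : Finset V, ∑ l ∈ L, C l ≤ ∑ l ∈ L, (C l - 1) + L.card := fun L => by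
    rw [Finset.card_eq_sum_ones, ← Finset.sum_add_distrib]
    exact Finset.sum_le_sum fun l _ => by omega
  have hAs := hsub A
  have hBs := hsub B
  have hAc : A ⊆ (P ∪ Q)ᶜ := Finset.filter_subset _ _
  have hsplit : ∑ l ∈ B, C l + ∑ l ∈ A, C l = ∑ l ∈ (P ∪ Q)ᶜ, C l := Finset.sum_sdiff hAc
  have hcardAB : B.card + A.card = (P ∪ Q)ᶜ.card := Finset.card_sdiff_add_card_eq_card hAc
  have hcardc : (P ∪ Q).card + (P ∪ Q)ᶜ.card = Fintype.card V := Finset.card_add_card_compl _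
  have htotal : ∑ l ∈ P ∪ Q, C l + ∑ l ∈ (P ∪ Q)ᶜ, C l = ∑ l, C l :=
    Finset.sum_add_sum_compl _ _
  have hunion : ∑ l ∈ P ∪ Q, C l ≤ ∑ l ∈ P, C l + ∑ l ∈ Q, C l := by
    rw [← Finset.sum_union_inter]; omega
  have hPc : G.dist r s + 1 ≤ (P ∪ Q).card := by
    rw [← hpl, ← p.length_support, ← List.toFinset_card_of_nodup hp.support_nodup]
    exact Finset.card_le_card Finset.subset_union_left
  have hQc : G.dist r t + 1 ≤ (P ∪ Q).card := by
    rw [← hql, ← q.length_support, ← List.toFinset_card_of_nodup hq.support_nodup]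
    exact Finset.card_le_card Finset.subset_union_right
  have harith := two_pow_add_two_pow_lt (hdiam r s) (hdiam r t) hsum hPc hQc
  omega

theorem twopath_cheap {V : Type} [Fintype V] [DecidableEq V]
    (G : SimpleGraph V) (hG : IsTwoPath G) (d n : ℕ)
    (hd : G.diam = d) (hn : Fintype.card V = n) (r : V)
    (C : V → ℕ) (hC : 2 ^ (d + 1) + n - 2 * d ≤ ∑ v, C v) :
    CheaplySolvable G C r (2 ^ eccentricity G r) ∧ CheaplySolvable G C r (2 ^ d) := by
  subst hd hn
  have h := hG.canBring_eccentricity r hC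
  have := hG.connected.nonempty
  have hle : eccentricity G r ≤ G.diam := Finset.sup_le fun v _ =>
    SimpleGraph.dist_le_diam (SimpleGraph.connected_iff_ediam_ne_top.1 hG.connected)
  exact ⟨h.cheaplySolvable, (h.mono_depth hle).cheaplySolvable⟩
end
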